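/- arXiv:1502.06139 — 8 statements merged into one kernel-verified Lean document; each statement's English description precedes it below -/
import Mathlib

section
/- Let Ω = (a,b) with -∞ < a < b < ∞ and |Ω| = b − a. Then for every t > 0, the heat content for the one-dimensional Cauchy kernel satisfies the exact identity H^{(1)}_{Ω,Ω^c}(t) = (2/π)·t·ln(1/t) + (2/π)·( |Ω|·arctan(t/|Ω|) + (1/2)·t·ln(t² + |Ω|²) ). -/
open MeasureTheory Real Filter Set Metric Topology

noncomputable def cauchyKernel1 (t x : ℝ) : ℝ :=
  (1 / Real.pi) * t / (t ^ 2 + x ^ 2)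

noncomputable def cauchyContent1 (t : ℝ) (A B : Set ℝ) : ℝ :=
  ∫ x in A, (∫ y in B, cauchyKernel1 t (x - y))

lemma cauchyKernel1_sub_eq {t : ℝ} (ht : 0 < t) (x y : ℝ) :
    cauchyKernel1 t (x - y) = (1 / (Real.pi * t)) * (1 + ((y - x) / t) ^ 2)⁻¹ := by
  have h : t ^ 2 + (x - y) ^ 2 ≠ 0 := by positivity
  have h' : 1 + ((y - x) / t) ^ 2 = (t ^ 2 + (x - y) ^ 2) / t ^ 2 := by
    field_simp
    ring
  rw [cauchyKernel1, h']
  field_simp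

lemma integrable_cauchyKernel1_sub {t : ℝ} (ht : 0 < t) (x : ℝ) :
    Integrable (fun y => cauchyKernel1 t (x - y)) := by
  simp_rw [cauchyKernel1_sub_eq ht]
  exact ((integrable_inv_one_add_sq.comp_div ht.ne').comp_sub_right x).const_mul _

lemma integral_cauchyKernel1_sub {t : ℝ} (ht : 0 < t) (x : ℝ) :
    ∫ y, cauchyKernel1 t (x - y) = 1 := by
  simp_rw [cauchyKernel1_sub_eq ht]
  rw [integral_const_mul, integral_sub_right_eq_self (fun y => (1 + (y / t) ^ 2)⁻¹) x,
    Measure.integral_comp_div (fun y => (1 + y ^ 2)⁻¹) t, integral_univ_inv_one_add_sq,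
    abs_of_pos ht, smul_eq_mul]
  field_simp

lemma setIntegral_Ioo_cauchyKernel1_sub {t : ℝ} (ht : 0 < t) {a b : ℝ} (hab : a ≤ b) (x : ℝ) :
    ∫ y in Ioo a b, cauchyKernel1 t (x - y)
      = (1 / Real.pi) * (arctan ((b - x) / t) + arctan ((x - a) / t)) := by
  rw [← integral_Ioc_eq_integral_Ioo, ← intervalIntegral.integral_of_le hab,
    intervalIntegral.integral_eq_sub_of_hasDerivAt
      (f := fun y => (1 / Real.pi) * arctan ((y - x) / t)) _
      (integrable_cauchyKernel1_sub ht x).intervalIntegrable]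
  · rw [← neg_sub x a, neg_div, arctan_neg]
    ring
  · intro y _
    refine ((((hasDerivAt_id' y).sub_const x).div_const t).arctan.const_mul
      (1 / Real.pi)).congr_deriv ?_
    rw [cauchyKernel1_sub_eq ht]
    field_simp

lemma setIntegral_compl_Ioo_cauchyKernel1_sub {t : ℝ} (ht : 0 < t) {a b : ℝ} (hab : a ≤ b)
    (x : ℝ) :
    ∫ y in (Ioo a b)ᶜ, cauchyKernel1 t (x - y)
      = 1 - (1 / Real.pi) * (arctan ((b - x) / t) + arctan ((x - a) / t)) := by
  rw [setIntegral_compl measurableSet_Ioo (integrable_cauchyKernel1_sub ht x),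
    integral_cauchyKernel1_sub ht, setIntegral_Ioo_cauchyKernel1_sub ht hab]

lemma integral_arctan_div {t : ℝ} (ht : 0 < t) (L : ℝ) :
    ∫ u in (0 : ℝ)..L, arctan (u / t)
      = L * arctan (L / t) - t / 2 * log (t ^ 2 + L ^ 2) + t * log t := by
  rw [intervalIntegral.integral_eq_sub_of_hasDerivAt
    (f := fun u => u * arctan (u / t) - t / 2 * log (t ^ 2 + u ^ 2))]
  · simp only [zero_mul, ne_eq, OfNat.ofNat_ne_zero, not_false_eq_true, zero_pow, add_zero, log_pow]
    push_cast
    ring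
  · intro u _
    have hu : t ^ 2 + u ^ 2 ≠ 0 := by positivity
    have hu' : 1 + (u / t) ^ 2 = (t ^ 2 + u ^ 2) / t ^ 2 := by field_simp
    refine (((hasDerivAt_id' u).fun_mul ((hasDerivAt_id' u).div_const t).arctan).fun_sub
      (((((hasDerivAt_id' u).fun_pow 2).const_add (t ^ 2)).log hu).const_mul
        (t / 2))).congr_deriv ?_
    rw [hu']
    field_simp
    simp
    ring
  · exact Continuous.intervalIntegrable (by fun_prop) _ _

/-- exact identity for the heat content of an interval for the Cauchy kernel. -/
theorem heat_content_interval_cauchy (a b : ℝ) (hab : a < b) (t : ℝ) (ht : 0 < t) :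
    cauchyContent1 t (Set.Ioo a b) (Set.Ioo a b)ᶜ
      = (2 / Real.pi) * t * Real.log (1/t)
        + (2 / Real.pi) * ((b - a) * Real.arctan (t / (b - a))
            + (1/2) * t * Real.log (t ^ 2 + (b - a) ^ 2)) := by
  have hL : 0 < b - a := sub_pos.2 hab
  have hb : ∫ x in a..b, arctan ((b - x) / t) = ∫ u in (0 : ℝ)..(b - a), arctan (u / t) := by
    simpa using intervalIntegral.integral_comp_sub_left (a := a) (b := b)
      (fun u => arctan (u / t)) b
  have ha : ∫ x in a..b, arctan ((x - a) / t) = ∫ u in (0 : ℝ)..(b - a), arctan (u / t) := by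
    simpa using intervalIntegral.integral_comp_sub_right (a := a) (b := b)
      (fun u => arctan (u / t)) a
  have harctan : arctan ((b - a) / t) = Real.pi / 2 - arctan (t / (b - a)) := by
    rw [← arctan_inv_of_pos (div_pos ht hL), inv_div]
  simp_rw [cauchyContent1, setIntegral_compl_Ioo_cauchyKernel1_sub ht hab.le]
  rw [← integral_Ioc_eq_integral_Ioo, ← intervalIntegral.integral_of_le hab.le,
    intervalIntegral.integral_sub (Continuous.intervalIntegrable (by fun_prop) _ _)
      (Continuous.intervalIntegrable (by fun_prop) _ _),
    intervalIntegral.integral_const_mul,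
    intervalIntegral.integral_add (Continuous.intervalIntegrable (by fun_prop) _ _)
      (Continuous.intervalIntegrable (by fun_prop) _ _),
    hb, ha, integral_arctan_div ht, harctan, intervalIntegral.integral_const, one_div t, log_inv,
    smul_eq_mul]
  field_simp
  ring
end

section
/- Let 0 < α ≤ 2, let -∞ < a < b < ∞ and t > 0. Then the heat content admits the scaling representation ∫_a^b ∫_{ℝ∖(a,b)} p_t^{(α)}(x−y) dy dx = 2·t^{1/α} · ∫_0^{(b−a)·t^{−1/α}} ( ∫_w^∞ p_1^{(α)}(z) dz ) dw. -/
open MeasureTheory Real Filter Set Metric Topology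

noncomputable def heatKernel1 (α t x : ℝ) : ℝ :=
  (1 / (2 * Real.pi)) * ∫ ξ : ℝ, Real.cos (x * ξ) * Real.exp (-t * |ξ| ^ α)

noncomputable def heatContent1 (α t : ℝ) (A B : Set ℝ) : ℝ :=
  ∫ x in A, (∫ y in B, heatKernel1 α t (x - y))

theorem integrable_of_even_of_integrableOn_Ioi {f : ℝ → ℝ} (hf : Continuous f)
    (hev : ∀ x, f (-x) = f x) {w : ℝ} (h : IntegrableOn f (Ioi w)) : Integrable f := by
  refine integrable_iff_integrableAtFilter_atBot_atTop.2
    ⟨⟨⟨Iio (-w), Iio_mem_atBot _, ?_⟩, ⟨Ioi w, Ioi_mem_atTop _, h⟩⟩, hf.locallyIntegrable⟩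
  have := ((Measure.measurePreserving_neg (volume : Measure ℝ)).integrableOn_comp_preimage
    (Homeomorph.neg ℝ).measurableEmbedding).2 h
  simpa [Function.comp_def, hev] using this

theorem integrable_exp_neg_abs_rpow {α t : ℝ} (hα : 0 < α) (ht : 0 < t) :
    Integrable fun ξ : ℝ => Real.exp (-t * |ξ| ^ α) := by
  refine integrable_of_even_of_integrableOn_Ioi (w := 0) ?_ (fun ξ => by rw [abs_neg]) ?_
  · exact Real.continuous_exp.comp
      (continuous_const.mul (continuous_abs.rpow_const fun _ => Or.inr hα.le))
  · refine (integrableOn_rpow_mul_exp_neg_mul_rpow (s := 0) (by norm_num) hα ht).congr_fun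
      (fun ξ hξ => ?_) measurableSet_Ioi
    simp [abs_of_pos (mem_Ioi.1 hξ)]

theorem continuous_heatKernel1 {α t : ℝ} (hα : 0 < α) (ht : 0 < t) :
    Continuous (heatKernel1 α t) := by
  refine continuous_const.mul ?_
  refine continuous_of_dominated (bound := fun ξ => Real.exp (-t * |ξ| ^ α)) (fun x => ?_)
    (fun x => .of_forall fun ξ => ?_) (integrable_exp_neg_abs_rpow hα ht)
    (.of_forall fun ξ => by fun_prop)
  · exact (by fun_prop : Continuous fun ξ : ℝ => Real.cos (x * ξ)).aestronglyMeasurable.mul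
      (integrable_exp_neg_abs_rpow hα ht).aestronglyMeasurable
  · rw [norm_mul, Real.norm_eq_abs, Real.norm_of_nonneg (Real.exp_nonneg _)]
    exact mul_le_of_le_one_left (Real.exp_nonneg _) (Real.abs_cos_le_one _)

theorem heatKernel1_neg (α t x : ℝ) : heatKernel1 α t (-x) = heatKernel1 α t x := by
  simp [heatKernel1]

theorem heatKernel1_scaling {α t : ℝ} (hα : 0 < α) (ht : 0 < t) (x : ℝ) :
    heatKernel1 α t x = t ^ (-1 / α) * heatKernel1 α 1 (x * t ^ (-1 / α)) := by
  have hc : 0 < t ^ (1 / α) := Real.rpow_pos_of_pos ht _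
  have hinv : t ^ (-1 / α) * t ^ (1 / α) = 1 := by
    rw [← Real.rpow_add ht, neg_div, neg_add_cancel, Real.rpow_zero]
  have key := Measure.integral_comp_mul_left
    (fun ξ : ℝ => Real.cos (x * t ^ (-1 / α) * ξ) * Real.exp (-1 * |ξ| ^ α)) (t ^ (1 / α))
  have hpt (ξ : ℝ) : Real.cos (x * t ^ (-1 / α) * (t ^ (1 / α) * ξ)) *
      Real.exp (-1 * |t ^ (1 / α) * ξ| ^ α) = Real.cos (x * ξ) * Real.exp (-t * |ξ| ^ α) := by
    rw [abs_mul, abs_of_pos hc, Real.mul_rpow hc.le (abs_nonneg _), ← Real.rpow_mul ht.le,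
      one_div_mul_cancel hα.ne', Real.rpow_one,
      show x * t ^ (-1 / α) * (t ^ (1 / α) * ξ) = x * (t ^ (-1 / α) * t ^ (1 / α)) * ξ by ring,
      hinv, mul_one, neg_one_mul, neg_mul]
  simp only [hpt] at key
  rw [heatKernel1, heatKernel1, key, abs_of_pos (inv_pos.2 hc),
    ← eq_inv_of_mul_eq_one_left hinv, smul_eq_mul]
  ring

theorem setIntegral_compl_Ioo_comp_sub {f : ℝ → ℝ} (hf : Continuous f)
    (hev : ∀ x, f (-x) = f x) {a b : ℝ} (hab : a < b) (x : ℝ) :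
    ∫ y in (Ioo a b)ᶜ, f (x - y) = (∫ z in Ioi (x - a), f z) + ∫ z in Ioi (b - x), f z := by
  have hset : (Ioo a b)ᶜ = Iic a ∪ Ici b := by
    ext y; simp only [mem_compl_iff, mem_Ioo, mem_union, mem_Iic, mem_Ici]; grind
  have hfx (y : ℝ) : f (x - y) = f (y - x) := by rw [← hev, neg_sub]
  have mpr := measurePreserving_sub_right (volume : Measure ℝ) x
  have mer : MeasurableEmbedding fun y : ℝ => y - x := (Homeomorph.subRight x).measurableEmbedding
  have preR : (fun y : ℝ => y - x) ⁻¹' Ici (b - x) = Ici b := by simp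
  by_cases hi : Integrable f
  · have hix : Integrable fun y => f (x - y) := hi.comp_sub_left x
    have mpl := (volume : Measure ℝ).measurePreserving_sub_left x
    have mel : MeasurableEmbedding fun y : ℝ => x - y := (Homeomorph.subLeft x).measurableEmbedding
    have preL : (fun y : ℝ => x - y) ⁻¹' Ici (x - a) = Iic a := by simp
    rw [hset, setIntegral_union (by
      rw [Set.disjoint_left]; intro y hy hy'; exact absurd (hy'.trans hy) (not_le.2 hab))
      measurableSet_Ici hix.integrableOn hix.integrableOn,
      ← integral_Ici_eq_integral_Ioi, ← integral_Ici_eq_integral_Ioi,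
      ← mpl.setIntegral_preimage_emb mel f (Ici (x - a)),
      ← mpr.setIntegral_preimage_emb mer f (Ici (b - x)), preL, preR]
    simp only [hfx]
  · have hzero (w : ℝ) : ∫ z in Ioi w, f z = 0 :=
      integral_undef fun h => hi (integrable_of_even_of_integrableOn_Ioi hf hev h)
    rw [hzero, hzero, add_zero]
    refine integral_undef fun h => hi ?_
    have h1 : IntegrableOn (fun y => f (x - y)) (Ici b) :=
      IntegrableOn.mono_set h (hset ▸ subset_union_right)
    simp only [hfx] at h1
    rw [← preR] at h1
    have h2 := (mpr.integrableOn_comp_preimage mer).1 h1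
    exact integrable_of_even_of_integrableOn_Ioi hf hev (h2.mono_set Ioi_subset_Ici_self)

theorem continuous_setIntegral_Ioi {f : ℝ → ℝ} (hf : Continuous f)
    (hev : ∀ x, f (-x) = f x) : Continuous fun w => ∫ z in Ioi w, f z := by
  by_cases hi : Integrable f
  · have h (w : ℝ) : ∫ z in Ioi w, f z = (∫ z in Ioi 0, f z) - ∫ z in (0 : ℝ)..w, f z := by
      rw [← intervalIntegral.integral_Ioi_sub_Ioi' hi.integrableOn hi.integrableOn, sub_sub_cancel]
    exact (continuous_const.sub (intervalIntegral.continuous_primitive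
      (fun _ _ => hf.intervalIntegrable _ _) _)).congr fun w => (h w).symm
  · have hzero (w : ℝ) : ∫ z in Ioi w, f z = 0 :=
      integral_undef fun h => hi (integrable_of_even_of_integrableOn_Ioi hf hev h)
    simp only [hzero]
    exact continuous_const

theorem setIntegral_Ioo_compl_Ioo_comp_sub {f : ℝ → ℝ} (hf : Continuous f)
    (hev : ∀ x, f (-x) = f x) {a b : ℝ} (hab : a < b) :
    ∫ x in Ioo a b, ∫ y in (Ioo a b)ᶜ, f (x - y) =
      2 * ∫ w in (0 : ℝ)..(b - a), ∫ z in Ioi w, f z := by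
  have hG := continuous_setIntegral_Ioi hf hev
  have hGa : Continuous fun x => ∫ z in Ioi (x - a), f z := hG.comp (by fun_prop)
  have hGb : Continuous fun x => ∫ z in Ioi (b - x), f z := hG.comp (by fun_prop)
  simp only [setIntegral_compl_Ioo_comp_sub hf hev hab]
  rw [← integral_Ioc_eq_integral_Ioo, ← intervalIntegral.integral_of_le hab.le,
    intervalIntegral.integral_add (hGa.intervalIntegrable _ _) (hGb.intervalIntegrable _ _),
    intervalIntegral.integral_comp_sub_right (fun w => ∫ z in Ioi w, f z),
    intervalIntegral.integral_comp_sub_left (fun w => ∫ z in Ioi w, f z), sub_self, sub_self,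
    two_mul]

theorem setIntegral_Ioi_heatKernel1 {α t : ℝ} (hα : 0 < α) (ht : 0 < t) (w : ℝ) :
    ∫ z in Ioi w, heatKernel1 α t z = ∫ z in Ioi (w * t ^ (-1 / α)), heatKernel1 α 1 z := by
  have hc : 0 < t ^ (-1 / α) := Real.rpow_pos_of_pos ht _
  simp only [heatKernel1_scaling hα ht]
  rw [integral_const_mul, integral_comp_mul_right_Ioi _ _ hc, smul_eq_mul,
    mul_inv_cancel_left₀ hc.ne']

/-- scaling representation of the heat content of an interval. -/
theorem heat_content_interval_scaling (α : ℝ) (h0 : 0 < α) (h2 : α ≤ 2)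
    (a b : ℝ) (hab : a < b) (t : ℝ) (ht : 0 < t) :
    ∫ x in Set.Ioo a b, (∫ y in (Set.Ioo a b)ᶜ, heatKernel1 α t (x - y))
      = 2 * t ^ (1/α) *
          ∫ w in Set.Ioo 0 ((b - a) * t ^ (-1/α)), (∫ z in Set.Ioi w, heatKernel1 α 1 z) := by
  have hc : 0 < t ^ (-1 / α) := Real.rpow_pos_of_pos ht _
  have hinv : (t ^ (-1 / α))⁻¹ = t ^ (1 / α) := by
    rw [neg_div, Real.rpow_neg ht.le, inv_inv]
  rw [setIntegral_Ioo_compl_Ioo_comp_sub (continuous_heatKernel1 h0 ht) (heatKernel1_neg α t) hab]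
  simp only [setIntegral_Ioi_heatKernel1 h0 ht]
  rw [intervalIntegral.integral_comp_mul_right
      (fun w => ∫ z in Ioi w, heatKernel1 α 1 z) hc.ne',
    zero_mul, hinv, smul_eq_mul, ← mul_assoc,
    intervalIntegral.integral_of_le (mul_pos (sub_pos.2 hab) hc).le, integral_Ioc_eq_integral_Ioo]
end

section
/- Let 1 < α ≤ 2. Then ∫_0^∞ z · p_1^{(α)}(z) dz = (1/π)·Γ(1 − 1/α), i.e. the truncated first moment of the symmetric α-stable density at time 1 over the positive half-line equals Γ(1 − 1/α)/π. -/
open MeasureTheory Real Filter Set Metric Topology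

theorem rpow_mul_exp_neg_rpow_le {α p q : ℝ} (hα : 0 < α) (hqp : q ≤ p) :
    ∃ C, 0 ≤ C ∧ ∀ x : ℝ, 0 < x → x ^ p * exp (-x ^ α) ≤ C * x ^ q := by
  have hs : 0 ≤ (p - q) / α := div_nonneg (by linarith) hα.le
  set s := (p - q) / α with hs'
  refine ⟨s ^ s, by positivity, fun x hx => ?_⟩
  have key : ∀ y : ℝ, 0 < y → y ^ s ≤ s ^ s * exp y := by
    intro y hy
    rcases hs.eq_or_lt with h0 | h0
    · rw [← h0]
      simpa using hy.le
    · have h1 : y ≤ s * exp (y / s) := by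
        have h2 : y / s ≤ exp (y / s) := by linarith [add_one_le_exp (y / s)]
        calc y = s * (y / s) := by field_simp
          _ ≤ _ := by gcongr
      calc y ^ s ≤ (s * exp (y / s)) ^ s := by gcongr
        _ = s ^ s * exp y := by
          rw [mul_rpow h0.le (exp_pos _).le, ← exp_mul, div_mul_cancel₀ _ h0.ne']
  have h := key (x ^ α) (by positivity)
  rw [← rpow_mul hx.le, hs', mul_div_cancel₀ _ hα.ne', ← hs'] at h
  calc x ^ p * exp (-x ^ α) = x ^ q * (x ^ (p - q) * exp (-x ^ α)) := by
        rw [← mul_assoc, ← rpow_add hx]; ring_nf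
    _ ≤ x ^ q * (s ^ s * exp (x ^ α) * exp (-x ^ α)) := by gcongr
    _ = s ^ s * x ^ q := by rw [mul_assoc (s ^ s), ← exp_add]; simp [mul_comm]

theorem hasDerivAt_rpow_mul_exp_neg_rpow (α p : ℝ) {x : ℝ} (hx : 0 < x) :
    HasDerivAt (fun x : ℝ => x ^ p * exp (-x ^ α))
      (p * (x ^ (p - 1) * exp (-x ^ α)) - α * (x ^ (p + α - 1) * exp (-x ^ α))) x := by
  have h1 := hasDerivAt_rpow_const (x := x) (p := p) (Or.inl hx.ne')
  have h2 := (hasDerivAt_rpow_const (x := x) (p := α) (Or.inl hx.ne')).neg.exp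
  refine (h1.mul h2).congr_deriv ?_
  rw [show p + α - 1 = p + (α - 1) by ring, rpow_add hx p]
  simp only [Pi.neg_apply]
  ring

theorem tendsto_rpow_mul_exp_neg_rpow_atTop {α : ℝ} (hα : 0 < α) (p : ℝ) :
    Tendsto (fun x : ℝ => x ^ p * exp (-x ^ α)) atTop (𝓝 0) := by
  obtain ⟨C, -, hC⟩ := rpow_mul_exp_neg_rpow_le hα (min_le_left p (-1))
  have hlim : Tendsto (fun x : ℝ => C * x ^ min p (-1)) atTop (𝓝 0) := by
    have := (tendsto_rpow_neg_atTop (y := -min p (-1))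
      (by linarith [min_le_right p (-1)])).const_mul C
    simpa using this
  refine squeeze_zero' ?_ ?_ hlim
  · filter_upwards [eventually_gt_atTop 0] with x hx
    positivity
  · filter_upwards [eventually_gt_atTop 0] with x hx using hC x hx

theorem tendsto_mul_atTop_of_abs_le {u v : ℝ → ℝ} {M : ℝ} {l : Filter ℝ}
    (hu : Tendsto u l (𝓝 0)) (hv : ∀ x, |v x| ≤ M) : Tendsto (u * v) l (𝓝 0) := by
  refine squeeze_zero_norm (a := fun x => |u x| * M) (fun x => ?_) ?_
  · rw [Pi.mul_apply, norm_mul, norm_eq_abs, norm_eq_abs]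
    exact mul_le_mul_of_nonneg_left (hv x) (abs_nonneg _)
  · simpa using hu.abs.mul_const M

theorem hasDerivAt_sin_mul_div {z : ℝ} (hz : z ≠ 0) (x : ℝ) :
    HasDerivAt (fun x => sin (z * x) / z) (cos (z * x)) x := by
  have := (((hasDerivAt_id x).const_mul z).sin).div_const z
  refine this.congr_deriv ?_
  simp only [id]
  field_simp

theorem hasDerivAt_neg_cos_mul_div {z : ℝ} (hz : z ≠ 0) (x : ℝ) :
    HasDerivAt (fun x => -cos (z * x) / z) (sin (z * x)) x := by
  have := (((hasDerivAt_id x).const_mul z).cos.neg).div_const z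
  refine this.congr_deriv ?_
  simp only [id]
  field_simp

theorem abs_div_le_inv {a z : ℝ} (hz : 0 < z) (ha : |a| ≤ 1) : |a / z| ≤ 1 / z := by
  rw [abs_div, abs_of_pos hz]
  gcongr

theorem integrableOn_mul_of_abs_le_one {f g : ℝ → ℝ} {s : Set ℝ} (hf : IntegrableOn f s)
    (hg : Measurable g) (hg1 : ∀ x, |g x| ≤ 1) : IntegrableOn (fun x => f x * g x) s :=
  Integrable.mul_bdd (c := 1) hf hg.aestronglyMeasurable (ae_of_all _ hg1)

theorem integral_Ioc_rpow_mul_exp_le {α p γ C c : ℝ} (hγ : -1 < γ) (hc : 0 < c)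
    (hC : ∀ x : ℝ, 0 < x → x ^ p * exp (-x ^ α) ≤ C * x ^ γ) (z : ℝ) :
    |∫ x in Ioc 0 c, x ^ p * exp (-x ^ α) * cos (z * x)| ≤ C * (c ^ (γ + 1) / (γ + 1)) := by
  have hint : IntegrableOn (fun x : ℝ => C * x ^ γ) (Ioc 0 c) :=
    ((intervalIntegral.intervalIntegrable_rpow' (a := 0) (b := c) hγ).const_mul C).1
  have hval : ∫ x in Ioc 0 c, C * x ^ γ = C * (c ^ (γ + 1) / (γ + 1)) := by
    rw [← intervalIntegral.integral_of_le hc.le, intervalIntegral.integral_const_mul,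
      integral_rpow (Or.inl hγ), zero_rpow (by linarith), sub_zero]
  rw [← hval, ← norm_eq_abs]
  refine norm_integral_le_of_norm_le hint ?_
  filter_upwards [ae_restrict_mem measurableSet_Ioc] with x hx
  have h0 : 0 ≤ x ^ p * exp (-x ^ α) := mul_nonneg (rpow_nonneg hx.1.le _) (exp_pos _).le
  rw [norm_mul, norm_eq_abs, norm_eq_abs, abs_of_nonneg h0]
  calc x ^ p * exp (-x ^ α) * |cos (z * x)| ≤ x ^ p * exp (-x ^ α) * 1 := by
        gcongr; exact abs_cos_le_one _
    _ ≤ _ := by rw [mul_one]; exact hC x hx.1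

/-- The cosine transform of `x ^ p * exp (-x ^ α)` decays at least like `z ^ (-γ - 1)` for every
`γ ≤ p` with `-1 < γ < 0`. -/
theorem abs_integral_rpow_mul_exp_mul_cos_le {α p γ : ℝ} (hα : 0 < α) (hγ : -1 < γ)
    (hγ0 : γ < 0) (hp : γ ≤ p) :
    ∃ C, ∀ z : ℝ, 0 < z →
      |∫ x in Ioi (0 : ℝ), x ^ p * exp (-x ^ α) * cos (z * x)| ≤ C * z ^ (-γ - 1) := by
  obtain ⟨C₀, hC₀, h₀⟩ := rpow_mul_exp_neg_rpow_le hα hp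
  obtain ⟨C₁, hC₁, h₁⟩ := rpow_mul_exp_neg_rpow_le hα (show γ - 1 ≤ p - 1 by linarith)
  obtain ⟨C₂, hC₂, h₂⟩ := rpow_mul_exp_neg_rpow_le hα (show γ - 1 ≤ p + α - 1 by linarith)
  set D := |p| * C₁ + α * C₂ with hD
  refine ⟨C₀ / (γ + 1) + C₀ + D / (-γ), fun z hz => ?_⟩
  have hc : 0 < z⁻¹ := by positivity
  set c := z⁻¹ with hcdef
  set w' : ℝ → ℝ := fun x => p * (x ^ (p - 1) * exp (-x ^ α)) -
    α * (x ^ (p + α - 1) * exp (-x ^ α)) with hw'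
  have hw'm : Measurable w' := by simp only [hw']; fun_prop
  have hw'le : ∀ x : ℝ, 0 < x → |w' x| ≤ D * x ^ (γ - 1) := by
    intro x hx
    have e1 := h₁ x hx
    have e2 := h₂ x hx
    have p1 : 0 ≤ x ^ (p - 1) * exp (-x ^ α) := by positivity
    have p2 : 0 ≤ x ^ (p + α - 1) * exp (-x ^ α) := by positivity
    calc |w' x| ≤ |p * (x ^ (p - 1) * exp (-x ^ α))| + |α * (x ^ (p + α - 1) * exp (-x ^ α))| :=
          abs_sub _ _
      _ = |p| * (x ^ (p - 1) * exp (-x ^ α)) + α * (x ^ (p + α - 1) * exp (-x ^ α)) := by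
          rw [abs_mul p, abs_mul α, abs_of_nonneg p1, abs_of_nonneg p2, abs_of_pos hα]
      _ ≤ |p| * (C₁ * x ^ (γ - 1)) + α * (C₂ * x ^ (γ - 1)) := by gcongr
      _ = _ := by rw [hD]; ring
  have hdom : IntegrableOn (fun x : ℝ => D * x ^ (γ - 1)) (Ioi c) :=
    (integrableOn_Ioi_rpow_of_lt (by linarith) hc).const_mul D
  have hw'int : IntegrableOn w' (Ioi c) := by
    refine hdom.mono' hw'm.aestronglyMeasurable ?_
    filter_upwards [ae_restrict_mem measurableSet_Ioi] with x hx
    exact hw'le x (hc.trans hx)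
  have hwint : IntegrableOn (fun x : ℝ => x ^ p * exp (-x ^ α)) (Ioi 0) :=
    integrableOn_rpow_mul_exp_neg_rpow (by linarith) hα
  have hwcint := integrableOn_mul_of_abs_le_one hwint (g := fun x => cos (z * x))
    (by fun_prop) (fun x => abs_cos_le_one _)
  have hv : ∀ x, |sin (z * x) / z| ≤ 1 / z := fun x => abs_div_le_inv hz (abs_sin_le_one _)
  have hibp := integral_Ioi_mul_deriv_eq_deriv_mul (a := c)
    (u := fun x : ℝ => x ^ p * exp (-x ^ α)) (u' := w')
    (v := fun x => sin (z * x) / z) (v' := fun x => cos (z * x))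
    (a' := c ^ p * exp (-c ^ α) * (sin (z * c) / z)) (b' := 0)
    (fun x hx => hasDerivAt_rpow_mul_exp_neg_rpow α p (hc.trans hx))
    (fun x _ => hasDerivAt_sin_mul_div hz.ne' x)
    (hwcint.mono_set (Ioi_subset_Ioi hc.le))
    (Integrable.mul_bdd (c := 1 / z) hw'int (by fun_prop) (ae_of_all _ hv))
    (by
      have hcont : ContinuousAt (fun x : ℝ => x ^ p * exp (-x ^ α) * (sin (z * x) / z)) c :=
        (hasDerivAt_rpow_mul_exp_neg_rpow α p hc).continuousAt.mul
          (hasDerivAt_sin_mul_div hz.ne' c).continuousAt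
      exact hcont.tendsto.mono_left nhdsWithin_le_nhds)
    (tendsto_mul_atTop_of_abs_le (tendsto_rpow_mul_exp_neg_rpow_atTop hα p) hv)
  have hsplit : ∫ x in Ioi (0 : ℝ), x ^ p * exp (-x ^ α) * cos (z * x) =
      (∫ x in Ioc 0 c, x ^ p * exp (-x ^ α) * cos (z * x)) +
        ∫ x in Ioi c, x ^ p * exp (-x ^ α) * cos (z * x) := by
    rw [← setIntegral_union (Ioc_disjoint_Ioi le_rfl) measurableSet_Ioi
      (hwcint.mono_set Ioc_subset_Ioi_self) (hwcint.mono_set (Ioi_subset_Ioi hc.le)),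
      Ioc_union_Ioi_eq_Ioi hc.le]
  have hcγ : ∀ s : ℝ, c ^ s = z ^ (-s) := fun s => by
    rw [hcdef, inv_rpow hz.le, rpow_neg hz.le]
  have b1 := integral_Ioc_rpow_mul_exp_le hγ hc h₀ z
  have b2 : |c ^ p * exp (-c ^ α) * (sin (z * c) / z)| ≤ C₀ * c ^ γ * (1 / z) := by
    rw [abs_mul, abs_of_nonneg (by positivity : 0 ≤ c ^ p * exp (-c ^ α))]
    exact mul_le_mul (h₀ c hc) (hv c) (abs_nonneg _) (by positivity)
  have b3 : |∫ x in Ioi c, w' x * (sin (z * x) / z)| ≤ D * (c ^ γ / (-γ)) * (1 / z) := by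
    have hval : ∫ x in Ioi c, D * x ^ (γ - 1) * (1 / z) = D * (c ^ γ / (-γ)) * (1 / z) := by
      rw [integral_mul_const, integral_const_mul, integral_Ioi_rpow_of_lt (by linarith) hc,
        sub_add_cancel, neg_div, div_neg]
    rw [← hval, ← norm_eq_abs]
    refine norm_integral_le_of_norm_le (hdom.mul_const _) ?_
    filter_upwards [ae_restrict_mem measurableSet_Ioi] with x hx
    rw [norm_mul]
    exact mul_le_mul (hw'le x (hc.trans hx)) (hv x) (norm_nonneg _)
      ((abs_nonneg _).trans (hw'le x (hc.trans hx)))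
  have hz1 : c ^ γ * (1 / z) = z ^ (-γ - 1) := by
    rw [hcγ, rpow_sub_one hz.ne']; ring
  have hz2 : c ^ (γ + 1) = z ^ (-γ - 1) := by rw [hcγ]; ring_nf
  rw [hsplit, hibp]
  rw [hz2] at b1
  rw [mul_assoc C₀, hz1] at b2
  rw [show D * (c ^ γ / (-γ)) * (1 / z) = D / (-γ) * (c ^ γ * (1 / z)) by ring, hz1] at b3
  rw [abs_le] at *
  constructor
  · linear_combination b1.1 + b2.2 + b3.2
  · linear_combination b1.2 + b2.1 + b3.1

theorem mul_integral_cos_mul_exp_neg_rpow {α z : ℝ} (hα : 0 < α) (hz : 0 < z) :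
    z * ∫ x in Ioi (0 : ℝ), cos (z * x) * exp (-x ^ α) =
      α * ∫ x in Ioi (0 : ℝ), x ^ (α - 1) * exp (-x ^ α) * sin (z * x) := by
  have hv : ∀ x, |sin (z * x) / z| ≤ 1 / z := fun x => abs_div_le_inv hz (abs_sin_le_one _)
  have hint0 : IntegrableOn (fun x : ℝ => x ^ (0 : ℝ) * exp (-x ^ α)) (Ioi 0) :=
    integrableOn_rpow_mul_exp_neg_rpow (by norm_num) hα
  have hint1 : IntegrableOn (fun x : ℝ => x ^ (α - 1) * exp (-x ^ α)) (Ioi 0) :=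
    integrableOn_rpow_mul_exp_neg_rpow (by linarith) hα
  have hibp := integral_Ioi_mul_deriv_eq_deriv_mul (a := 0)
    (u := fun x : ℝ => x ^ (0 : ℝ) * exp (-x ^ α))
    (u' := fun x => -α * (x ^ (α - 1) * exp (-x ^ α)))
    (v := fun x => sin (z * x) / z) (v' := fun x => cos (z * x))
    (a' := 0) (b' := 0)
    (fun x hx => (hasDerivAt_rpow_mul_exp_neg_rpow α 0 hx).congr_deriv (by ring_nf))
    (fun x _ => hasDerivAt_sin_mul_div hz.ne' x)
    (integrableOn_mul_of_abs_le_one hint0 (by fun_prop) (fun x => abs_cos_le_one _))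
    (Integrable.mul_bdd (c := 1 / z) (hint1.const_mul _) (by fun_prop) (ae_of_all _ hv))
    (by
      have hcont : Continuous (fun x : ℝ => x ^ (0 : ℝ) * exp (-x ^ α) * (sin (z * x) / z)) := by
        simp only [rpow_zero, one_mul]
        have : Continuous fun x : ℝ => x ^ α := continuous_rpow_const hα.le
        fun_prop
      have := (hcont.tendsto 0).mono_left (nhdsWithin_le_nhds (s := Ioi 0))
      simpa [Pi.mul_def] using this)
    (tendsto_mul_atTop_of_abs_le (tendsto_rpow_mul_exp_neg_rpow_atTop hα 0) hv)
  have e1 : ∫ x in Ioi (0 : ℝ), cos (z * x) * exp (-x ^ α) =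
      ∫ x in Ioi (0 : ℝ), x ^ (0 : ℝ) * exp (-x ^ α) * cos (z * x) := by
    simp [mul_comm]
  rw [e1, hibp, sub_self, zero_sub, ← integral_neg, ← integral_const_mul, ← integral_const_mul]
  refine integral_congr_ae (ae_of_all _ fun x => ?_)
  simp only
  field_simp

theorem mul_integral_rpow_mul_exp_mul_sin {α z : ℝ} (hα : 1 < α) (hz : 0 < z) :
    z * ∫ x in Ioi (0 : ℝ), x ^ (α - 1) * exp (-x ^ α) * sin (z * x) =
      (α - 1) * (∫ x in Ioi (0 : ℝ), x ^ (α - 2) * exp (-x ^ α) * cos (z * x)) -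
        α * ∫ x in Ioi (0 : ℝ), x ^ (2 * α - 2) * exp (-x ^ α) * cos (z * x) := by
  have hα0 : 0 < α := by linarith
  have hv : ∀ x, |-cos (z * x) / z| ≤ 1 / z :=
    fun x => abs_div_le_inv hz (by rw [abs_neg]; exact abs_cos_le_one _)
  have hint : ∀ p : ℝ, -1 < p → IntegrableOn (fun x : ℝ => x ^ p * exp (-x ^ α)) (Ioi 0) :=
    fun p hp => integrableOn_rpow_mul_exp_neg_rpow hp hα0
  have hcint : ∀ p : ℝ, -1 < p →
      IntegrableOn (fun x : ℝ => x ^ p * exp (-x ^ α) * cos (z * x)) (Ioi 0) :=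
    fun p hp => integrableOn_mul_of_abs_le_one (hint p hp) (by fun_prop)
      (fun x => abs_cos_le_one _)
  have hibp := integral_Ioi_mul_deriv_eq_deriv_mul (a := 0)
    (u := fun x : ℝ => x ^ (α - 1) * exp (-x ^ α))
    (u' := fun x => (α - 1) * (x ^ (α - 2) * exp (-x ^ α)) -
      α * (x ^ (2 * α - 2) * exp (-x ^ α)))
    (v := fun x => -cos (z * x) / z) (v' := fun x => sin (z * x))
    (a' := 0) (b' := 0)
    (fun x hx => (hasDerivAt_rpow_mul_exp_neg_rpow α (α - 1) hx).congr_deriv (by ring_nf))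
    (fun x _ => hasDerivAt_neg_cos_mul_div hz.ne' x)
    (integrableOn_mul_of_abs_le_one (hint _ (by linarith)) (by fun_prop)
      (fun x => abs_sin_le_one _))
    (Integrable.mul_bdd (c := 1 / z)
      (((hint _ (by linarith)).const_mul _).sub ((hint _ (by linarith)).const_mul _))
      (by fun_prop) (ae_of_all _ hv))
    (by
      have hcont : Continuous (fun x : ℝ => x ^ (α - 1) * exp (-x ^ α) * (-cos (z * x) / z)) := by
        have h1 : Continuous fun x : ℝ => x ^ α := continuous_rpow_const hα0.le
        have h2 : Continuous fun x : ℝ => x ^ (α - 1) := continuous_rpow_const (by linarith)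
        fun_prop
      have := (hcont.tendsto 0).mono_left (nhdsWithin_le_nhds (s := Ioi 0))
      simpa [Pi.mul_def, zero_rpow (show α - 1 ≠ 0 by linarith)] using this)
    (tendsto_mul_atTop_of_abs_le (tendsto_rpow_mul_exp_neg_rpow_atTop hα0 _) hv)
  rw [hibp, sub_self, zero_sub, ← integral_neg, ← integral_const_mul, ← integral_const_mul,
    ← integral_const_mul, ← integral_sub ((hcint _ (by linarith)).const_mul _)
      ((hcint _ (by linarith)).const_mul _)]
  refine integral_congr_ae (ae_of_all _ fun x => ?_)
  simp only
  field_simp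

theorem integrableOn_integral_rpow_mul_exp_mul_sin {α : ℝ} (hα : 1 < α) :
    IntegrableOn (fun z => ∫ x in Ioi (0 : ℝ), x ^ (α - 1) * exp (-x ^ α) * sin (z * x))
      (Ioi 0) := by
  have hα0 : 0 < α := by linarith
  set γ := min (α - 2) (-1 / 2) with hγdef
  have hγ : -1 < γ := lt_min (by linarith) (by norm_num)
  have hγ0 : γ < 0 := (min_le_right _ _).trans_lt (by norm_num)
  have hγα : γ ≤ α - 2 := min_le_left _ _
  obtain ⟨C, hC⟩ := abs_integral_rpow_mul_exp_mul_cos_le hα0 hγ hγ0 hγα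
  obtain ⟨C', hC'⟩ := abs_integral_rpow_mul_exp_mul_cos_le hα0 hγ hγ0
    (show γ ≤ 2 * α - 2 by linarith)
  have hint : IntegrableOn (fun x : ℝ => x ^ (α - 1) * exp (-x ^ α)) (Ioi 0) :=
    integrableOn_rpow_mul_exp_neg_rpow (by linarith) hα0
  have hmeas : AEStronglyMeasurable
      (fun z => ∫ x in Ioi (0 : ℝ), x ^ (α - 1) * exp (-x ^ α) * sin (z * x)) volume := by
    have : StronglyMeasurable
        (Function.uncurry fun z x : ℝ => x ^ (α - 1) * exp (-x ^ α) * sin (z * x)) := by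
      apply Measurable.stronglyMeasurable
      simp only [Function.uncurry_def]
      fun_prop
    exact this.integral_prod_right.aestronglyMeasurable
  suffices h : IntegrableOn (fun z => ∫ x in Ioi (0 : ℝ), x ^ (α - 1) * exp (-x ^ α) *
      sin (z * x)) (Ioc 0 1 ∪ Ioi 1) by
    rwa [Ioc_union_Ioi_eq_Ioi zero_le_one] at h
  refine IntegrableOn.union ?_ ?_
  · refine Integrable.mono' (g := fun _ => ∫ x in Ioi (0 : ℝ), x ^ (α - 1) * exp (-x ^ α))
      (integrableOn_const (by simp)) hmeas.restrict (ae_of_all _ fun z => ?_)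
    refine norm_integral_le_of_norm_le hint ?_
    filter_upwards [ae_restrict_mem measurableSet_Ioi] with x hx
    have h0 : 0 ≤ x ^ (α - 1) * exp (-x ^ α) := mul_nonneg (rpow_nonneg hx.le _) (exp_pos _).le
    rw [norm_mul, norm_eq_abs, norm_eq_abs, abs_of_nonneg h0]
    exact mul_le_of_le_one_right h0 (abs_sin_le_one _)
  · refine Integrable.mono' (g := fun z => ((α - 1) * C + α * C') * z ^ (-γ - 2))
      ((integrableOn_Ioi_rpow_of_lt (by linarith) one_pos).const_mul _) hmeas.restrict ?_
    filter_upwards [ae_restrict_mem measurableSet_Ioi] with z hz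
    have hz0 : 0 < z := one_pos.trans hz
    have h := mul_integral_rpow_mul_exp_mul_sin hα hz0
    set S := ∫ x in Ioi (0 : ℝ), x ^ (α - 1) * exp (-x ^ α) * sin (z * x)
    have h1 := hC z hz0
    have h2 := hC' z hz0
    set A := ∫ x in Ioi (0 : ℝ), x ^ (α - 2) * exp (-x ^ α) * cos (z * x)
    set B := ∫ x in Ioi (0 : ℝ), x ^ (2 * α - 2) * exp (-x ^ α) * cos (z * x)
    have h3 : z * |S| ≤ z * (((α - 1) * C + α * C') * z ^ (-γ - 2)) := by
      calc z * |S| = |z * S| := by rw [abs_mul, abs_of_pos hz0]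
        _ ≤ |(α - 1) * A| + |α * B| := by rw [h]; exact abs_sub _ _
        _ = (α - 1) * |A| + α * |B| := by
          rw [abs_mul, abs_mul, abs_of_pos hα0, abs_of_pos (show 0 < α - 1 by linarith)]
        _ ≤ (α - 1) * (C * z ^ (-γ - 1)) + α * (C' * z ^ (-γ - 1)) := by
          gcongr
        _ = _ := by
          rw [show -γ - 1 = -γ - 2 + 1 by ring, rpow_add_one hz0.ne']; ring
    exact le_of_mul_le_mul_left h3 hz0

theorem intervalIntegral_integral_rpow_mul_exp_mul_sin {α R : ℝ} (hα : 1 < α) :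
    ∫ z in (0 : ℝ)..R, ∫ x in Ioi (0 : ℝ), x ^ (α - 1) * exp (-x ^ α) * sin (z * x) =
      (∫ x in Ioi (0 : ℝ), x ^ (α - 2) * exp (-x ^ α)) -
        ∫ x in Ioi (0 : ℝ), x ^ (α - 2) * exp (-x ^ α) * cos (R * x) := by
  have hα0 : 0 < α := by linarith
  have hint1 : IntegrableOn (fun x : ℝ => x ^ (α - 1) * exp (-x ^ α)) (Ioi 0) :=
    integrableOn_rpow_mul_exp_neg_rpow (by linarith) hα0
  have hint2 : IntegrableOn (fun x : ℝ => x ^ (α - 2) * exp (-x ^ α)) (Ioi 0) :=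
    integrableOn_rpow_mul_exp_neg_rpow (by linarith) hα0
  have hone : Integrable (fun _ : ℝ => (1 : ℝ)) (volume.restrict (uIoc 0 R)) :=
    integrableOn_const (by simp [uIoc])
  rw [intervalIntegral_integral_swap]
  · rw [← integral_sub hint2 (integrableOn_mul_of_abs_le_one hint2 (by fun_prop)
      (fun x => abs_cos_le_one _))]
    refine setIntegral_congr_fun measurableSet_Ioi fun x (hx : 0 < x) => ?_
    rw [intervalIntegral.integral_const_mul, intervalIntegral.integral_comp_mul_right _ hx.ne',
      integral_sin, show α - 1 = α - 2 + 1 by ring, rpow_add_one hx.ne']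
    simp only [zero_mul, cos_zero, smul_eq_mul]
    field_simp
  · have hprod := hone.mul_prod hint1
    have := Integrable.mul_bdd (g := fun q : ℝ × ℝ => sin (q.1 * q.2)) (c := 1) hprod (by fun_prop)
      (ae_of_all _ fun q => abs_sin_le_one _)
    simpa [Function.uncurry_def] using this

theorem integral_integral_rpow_mul_exp_mul_sin {α : ℝ} (hα : 1 < α) :
    ∫ z in Ioi (0 : ℝ), ∫ x in Ioi (0 : ℝ), x ^ (α - 1) * exp (-x ^ α) * sin (z * x) =
      ∫ x in Ioi (0 : ℝ), x ^ (α - 2) * exp (-x ^ α) := by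
  have hα0 : 0 < α := by linarith
  have h := intervalIntegral_tendsto_integral_Ioi 0
    (integrableOn_integral_rpow_mul_exp_mul_sin hα) tendsto_id
  refine tendsto_nhds_unique h ?_
  simp only [id, intervalIntegral_integral_rpow_mul_exp_mul_sin hα]
  have hγ : -1 < min (α - 2) (-1 / 2) := lt_min (by linarith) (by norm_num)
  obtain ⟨C, hC⟩ := abs_integral_rpow_mul_exp_mul_cos_le hα0 hγ
    ((min_le_right _ _).trans_lt (by norm_num)) (min_le_left _ _)
  set γ := min (α - 2) (-1 / 2)
  have hlim : Tendsto (fun R : ℝ => C * R ^ (-γ - 1)) atTop (𝓝 0) := by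
    have := (tendsto_rpow_neg_atTop (y := γ + 1) (by linarith)).const_mul C
    simpa [sub_eq_add_neg, add_comm] using this
  have hcos : Tendsto
      (fun R : ℝ => ∫ x in Ioi (0 : ℝ), x ^ (α - 2) * exp (-x ^ α) * cos (R * x))
      atTop (𝓝 0) := by
    refine squeeze_zero_norm' ?_ hlim
    filter_upwards [eventually_gt_atTop 0] with R hR using hC R hR
  simpa using hcos.const_sub (∫ x in Ioi (0 : ℝ), x ^ (α - 2) * exp (-x ^ α))

theorem heatKernel1_one_eq (α z : ℝ) :
    heatKernel1 α 1 z = (1 / π) * ∫ x in Ioi (0 : ℝ), cos (z * x) * exp (-x ^ α) := by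
  have h := integral_comp_abs (f := fun x : ℝ => cos (z * x) * exp (-x ^ α))
  have h' : ∫ ξ : ℝ, cos (z * ξ) * exp (-1 * |ξ| ^ α) =
      ∫ ξ : ℝ, cos (z * |ξ|) * exp (-|ξ| ^ α) := by
    refine integral_congr_ae (ae_of_all _ fun ξ => ?_)
    rcases abs_choice ξ with hξ | hξ <;> simp [hξ]
  rw [heatKernel1, h', h]
  field_simp

/-- `∫_0^∞ z p_1^{(α)}(z) dz = Γ(1 - 1/α)/π` for `1 < α ≤ 2`. -/
theorem stable_truncated_first_moment (α : ℝ) (h1 : 1 < α) (h2 : α ≤ 2) :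
    ∫ z in Set.Ioi (0 : ℝ), z * heatKernel1 α 1 z = (1 / Real.pi) * Real.Gamma (1 - 1/α) := by
  have hα0 : 0 < α := by linarith
  have hstep : ∫ z in Set.Ioi (0 : ℝ), z * heatKernel1 α 1 z = ∫ z in Set.Ioi (0 : ℝ),
      (α / π) * ∫ x in Ioi (0 : ℝ), x ^ (α - 1) * exp (-x ^ α) * sin (z * x) := by
    refine setIntegral_congr_fun measurableSet_Ioi fun z (hz : 0 < z) => ?_
    have := mul_integral_cos_mul_exp_neg_rpow hα0 hz
    simp only [heatKernel1_one_eq]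
    linear_combination (1 / π) * this
  rw [hstep, integral_const_mul, integral_integral_rpow_mul_exp_mul_sin h1,
    integral_rpow_mul_exp_neg_rpow hα0 (by linarith),
    show (α - 2 + 1) / α = 1 - 1 / α by field_simp; ring]
  field_simp
end

section
/- Let 0 < α < 1. Then lim_{n→∞} ( Γ(nα+1)/(n·n!) )^{1/n} = 0. -/
open MeasureTheory Real Filter Set Metric Topology

lemma Gamma_natCast_mul_add_one_le_factorial_rpow {α : ℝ} (h0 : 0 < α) (h1 : α < 1) (n : ℕ) :
    Real.Gamma (n * α + 1) ≤ (n.factorial : ℝ) ^ α := by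
  have h := Real.Gamma_mul_add_mul_le_rpow_Gamma_mul_rpow_Gamma (s := (n : ℝ) + 1) (t := 1)
    (by positivity) one_pos h0 (sub_pos.2 h1) (by ring)
  rw [Real.Gamma_nat_eq_factorial, Real.Gamma_one, Real.one_rpow] at h
  rw [mul_one (_ ^ _), show α * ((n : ℝ) + 1) + (1 - α) * 1 = n * α + 1 by ring] at h
  exact h

lemma div_exp_one_pow_le_factorial (n : ℕ) :
    ((n : ℝ) / Real.exp 1) ^ n ≤ n.factorial := by
  have h := Real.pow_div_factorial_le_exp (n : ℝ) n.cast_nonneg n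
  rw [div_le_iff₀ (by positivity)] at h
  rw [div_pow, ← Real.exp_nat_mul, mul_one, div_le_iff₀ (Real.exp_pos _)]
  linarith

lemma Gamma_ratio_root_le {α : ℝ} (h0 : 0 < α) (h1 : α < 1) {n : ℕ} (hn : 1 ≤ n) :
    (Real.Gamma (n * α + 1) / (n * n.factorial)) ^ ((1 : ℝ) / n) ≤
      ((n : ℝ) / Real.exp 1) ^ (-(1 - α)) := by
  have hn' : (1 : ℝ) ≤ n := by exact_mod_cast hn
  have hf : (0 : ℝ) < n.factorial := by positivity
  have hpos : 0 < (n : ℝ) / Real.exp 1 := by positivity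
  have hratio : Real.Gamma (n * α + 1) / (n * n.factorial) ≤
      (((n : ℝ) / Real.exp 1) ^ n) ^ (-(1 - α)) := calc
    _ ≤ (n.factorial : ℝ) ^ α / n.factorial := by
      gcongr
      · exact Gamma_natCast_mul_add_one_le_factorial_rpow h0 h1 n
      · exact le_mul_of_one_le_left hf.le hn'
    _ = (n.factorial : ℝ) ^ (-(1 - α)) := by
      rw [neg_sub, Real.rpow_sub_one hf.ne']
    _ ≤ _ := Real.rpow_le_rpow_of_nonpos (by positivity) (div_exp_one_pow_le_factorial n)
      (by linarith)
  have hΓ : 0 < Real.Gamma (n * α + 1) := Real.Gamma_pos_of_pos (by positivity)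
  calc
    _ ≤ ((((n : ℝ) / Real.exp 1) ^ n) ^ (-(1 - α))) ^ ((1 : ℝ) / n) := by gcongr
    _ = _ := by
      rw [← Real.rpow_natCast, ← Real.rpow_mul hpos.le, ← Real.rpow_mul hpos.le]
      congr 1
      field_simp

/-- `(Γ(nα+1)/(n·n!))^{1/n} → 0` for `0 < α < 1`. -/
theorem gamma_ratio_root_tendsto_zero (α : ℝ) (h0 : 0 < α) (h1 : α < 1) :
    Filter.Tendsto
      (fun n : ℕ => (Real.Gamma (n * α + 1) / (n * n.factorial)) ^ ((1 : ℝ)/n))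
      Filter.atTop (nhds 0) := by
  have hlim : Tendsto (fun n : ℕ => ((n : ℝ) / Real.exp 1) ^ (-(1 - α))) atTop (𝓝 0) :=
    (tendsto_rpow_neg_atTop (sub_pos.2 h1)).comp
      (tendsto_natCast_atTop_atTop.atTop_div_const (Real.exp_pos 1))
  refine squeeze_zero' (Eventually.of_forall fun n => ?_) ?_ hlim
  · have : 0 < Real.Gamma (n * α + 1) := Real.Gamma_pos_of_pos (by positivity)
    positivity
  · filter_upwards [eventually_ge_atTop 1] with n hn
    exact Gamma_ratio_root_le h0 h1 hn
end

section
/- Let d ≥ 2, let δ, ε > 0, and let φ ∈ C_c^1(ℝ^d) (continuously differentiable with compact support). Writing points of ℝ^d as x = (x̄, x_d) with x̄ ∈ ℝ^{d−1}, there exists a constant C > 0 (depending on ε, δ and φ) such that for all t with 0 < t < e^{−1}: | ∫_{ℝ^{d−1}×(0,δ)} φ(x) ( ∫_{ℝ^{d−1}×(−ε,0)} p_t^{(1)}(x−y) dy ) dx − (1/π)·( ∫_{ℝ^{d−1}} φ(x̄, 0) dx̄ )·t·ln(1/t) | ≤ C·t. -/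
open MeasureTheory Real Filter Set Metric Topology

theorem pi_div_two_sub_arctan_div_le {x t : ℝ} (hx : 0 < x) (ht : 0 < t) :
    π / 2 - arctan (x / t) ≤ t / x := by
  have h : 0 < t / x := div_pos ht hx
  rw [← arctan_inv_of_pos (div_pos hx ht), inv_div]
  simpa [tan_arctan] using le_tan (arctan_nonneg.2 h.le) (arctan_lt_pi_div_two _)

theorem hasDerivAt_radial_primitive {n : ℕ} (hn : n ≠ 0) {A y : ℝ} (hA : 0 < A) :
    HasDerivAt (fun y : ℝ => (n * A)⁻¹ * (y ^ n * (A + y ^ 2) ^ (-(n / 2 : ℝ))))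
      (y ^ (n - 1) * (A + y ^ 2) ^ (-(n / 2 + 1 : ℝ))) y := by
  have hB : 0 < A + y ^ 2 := by positivity
  have h := (((hasDerivAt_pow n y).mul
    (((hasDerivAt_pow 2 y).const_add A).rpow_const (p := -(n / 2 : ℝ)) (Or.inl hB.ne')))).const_mul
      (n * A : ℝ)⁻¹
  refine h.congr_deriv ?_
  have e : (A + y ^ 2) ^ (-(n / 2 : ℝ)) = (A + y ^ 2) * (A + y ^ 2) ^ (-(n / 2 + 1 : ℝ)) := by
    rw [← rpow_one_add' hB.le] <;> ring_nf
    have : (0 : ℝ) < n := by positivity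
    linarith
  have e2 : (-(n / 2 : ℝ) - 1) = -(n / 2 + 1 : ℝ) := by ring
  have e3 : y ^ n = y ^ (n - 1) * y := (pow_sub_one_mul hn y).symm
  rw [e2, e, e3]
  have : (n : ℝ) ≠ 0 := by positivity
  push_cast
  field_simp
  ring

theorem tendsto_radial_primitive (n : ℕ) {A : ℝ} (hA : 0 < A) :
    Tendsto (fun y : ℝ => (n * A)⁻¹ * (y ^ n * (A + y ^ 2) ^ (-(n / 2 : ℝ)))) atTop
      (𝓝 (n * A)⁻¹) := by
  have h : Tendsto (fun y : ℝ => (n * A)⁻¹ * (A * (y ^ 2)⁻¹ + 1) ^ (-(n / 2 : ℝ))) atTop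
      (𝓝 ((n * A)⁻¹ * (A * 0 + 1) ^ (-(n / 2 : ℝ)))) := by
    refine Tendsto.const_mul _ (Tendsto.rpow_const ?_ (Or.inl (by norm_num)))
    exact (((tendsto_pow_atTop two_ne_zero).inv_tendsto_atTop).const_mul A).add_const 1
  simp only [mul_zero, zero_add, one_rpow, mul_one] at h
  refine h.congr' ?_
  filter_upwards [eventually_gt_atTop 0] with y hy
  have e : A + y ^ 2 = y ^ 2 * (A * (y ^ 2)⁻¹ + 1) := by field_simp
  have e2 : (y ^ 2) ^ (-(n / 2 : ℝ)) = (y ^ n)⁻¹ := by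
    rw [← rpow_natCast y 2, ← rpow_mul hy.le, ← rpow_natCast y n, ← rpow_neg hy.le]
    congr 1; push_cast; ring
  rw [e, mul_rpow (by positivity) (by positivity), e2, mul_inv_cancel_left₀ (by positivity)]

theorem integrableOn_radial {n : ℕ} (hn : n ≠ 0) {A : ℝ} (hA : 0 < A) :
    IntegrableOn (fun y : ℝ => y ^ (n - 1) * (A + y ^ 2) ^ (-(n / 2 + 1 : ℝ))) (Ioi 0) := by
  refine integrableOn_Ioi_deriv_of_nonneg' (fun y _ => hasDerivAt_radial_primitive hn hA)
    (fun y hy => ?_) (tendsto_radial_primitive n hA)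
  have := mem_Ioi.1 hy
  positivity

theorem integral_radial {n : ℕ} (hn : n ≠ 0) {A : ℝ} (hA : 0 < A) :
    ∫ y in Ioi (0 : ℝ), y ^ (n - 1) * (A + y ^ 2) ^ (-(n / 2 + 1 : ℝ)) = (n * A)⁻¹ := by
  rw [integral_Ioi_of_hasDerivAt_of_nonneg' (fun y _ => hasDerivAt_radial_primitive hn hA)
    (fun y hy => ?_) (tendsto_radial_primitive n hA)]
  · simp [hn]
  · have := mem_Ioi.1 hy
    positivity

theorem integrable_add_norm_sq_rpow {n : ℕ} (hn : n ≠ 0) {A : ℝ} (hA : 0 < A) :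
    Integrable fun y : EuclideanSpace ℝ (Fin n) => (A + ‖y‖ ^ 2) ^ (-(n / 2 + 1 : ℝ)) := by
  have : Nonempty (Fin n) := ⟨⟨0, Nat.pos_of_ne_zero hn⟩⟩
  rw [integrable_fun_norm_addHaar volume (f := fun r : ℝ => (A + r ^ 2) ^ (-(n / 2 + 1 : ℝ)))]
  simpa using integrableOn_radial hn hA

theorem integral_add_norm_sq_rpow {n : ℕ} (hn : n ≠ 0) {A : ℝ} (hA : 0 < A) :
    ∫ y : EuclideanSpace ℝ (Fin n), (A + ‖y‖ ^ 2) ^ (-(n / 2 + 1 : ℝ)) =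
      π ^ (n / 2 : ℝ) / Gamma (n / 2 + 1) * A⁻¹ := by
  have : Nonempty (Fin n) := ⟨⟨0, Nat.pos_of_ne_zero hn⟩⟩
  have hG : 0 < Gamma (n / 2 + 1 : ℝ) := Gamma_pos_of_pos (by positivity)
  rw [integral_fun_norm_addHaar volume (fun r : ℝ => (A + r ^ 2) ^ (-(n / 2 + 1 : ℝ)))]
  simp only [finrank_euclideanSpace, Fintype.card_fin, smul_eq_mul, integral_radial hn hA,
    measureReal_def, EuclideanSpace.volume_ball]
  have hs : √π ^ n = π ^ (n / 2 : ℝ) := by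
    rw [sqrt_eq_rpow, ← rpow_natCast, ← rpow_mul pi_pos.le]
    congr 1; ring
  have : (n : ℝ) ≠ 0 := by positivity
  rw [hs]
  simp
  rw [ENNReal.toReal_ofReal (by positivity)]
  field_simp

theorem integral_cauchy_slab {n : ℕ} (hn : n ≠ 0) {ε t : ℝ} (hε : 0 < ε) (ht : 0 < t)
    (xb : EuclideanSpace ℝ (Fin n)) (xd : ℝ) :
    ∫ yb : EuclideanSpace ℝ (Fin n), ∫ yd in Set.Ioo (-ε) 0,
      (Gamma ((((n + 1 : ℕ) : ℝ) + 1) / 2) / π ^ ((((n + 1 : ℕ) : ℝ) + 1) / 2)) * t /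
        (t ^ 2 + ‖xb - yb‖ ^ 2 + (xd - yd) ^ 2) ^ ((((n + 1 : ℕ) : ℝ) + 1) / 2) =
      (arctan ((xd + ε) / t) - arctan (xd / t)) / π := by
  have hp : (((n + 1 : ℕ) : ℝ) + 1) / 2 = n / 2 + 1 := by push_cast; ring
  rw [hp]
  set c : ℝ := Gamma (n / 2 + 1) / π ^ (n / 2 + 1 : ℝ) * t with hc
  have hG : 0 < Gamma (n / 2 + 1 : ℝ) := Gamma_pos_of_pos (by positivity)
  have hc0 : 0 < c := by positivity
  have hA (s : ℝ) : 0 < t ^ 2 + s ^ 2 := by positivity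
  have hK (yb : EuclideanSpace ℝ (Fin n)) (yd : ℝ) :
      c / (t ^ 2 + ‖xb - yb‖ ^ 2 + (xd - yd) ^ 2) ^ (n / 2 + 1 : ℝ) =
        c * ((t ^ 2 + (xd - yd) ^ 2) + ‖xb - yb‖ ^ 2) ^ (-(n / 2 + 1 : ℝ)) := by
    rw [rpow_neg (by positivity), div_eq_mul_inv, add_right_comm]
  simp only [hK]
  have hint (yd : ℝ) : Integrable fun yb : EuclideanSpace ℝ (Fin n) =>
      c * ((t ^ 2 + (xd - yd) ^ 2) + ‖xb - yb‖ ^ 2) ^ (-(n / 2 + 1 : ℝ)) :=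
    ((integrable_add_norm_sq_rpow hn (hA (xd - yd))).comp_sub_left xb).const_mul c
  have hval (yd : ℝ) : ∫ yb : EuclideanSpace ℝ (Fin n),
      c * ((t ^ 2 + (xd - yd) ^ 2) + ‖xb - yb‖ ^ 2) ^ (-(n / 2 + 1 : ℝ)) =
        π⁻¹ * (t / (t ^ 2 + (xd - yd) ^ 2)) := by
    rw [integral_const_mul, integral_sub_left_eq_self
      (fun z : EuclideanSpace ℝ (Fin n) =>
        ((t ^ 2 + (xd - yd) ^ 2) + ‖z‖ ^ 2) ^ (-(n / 2 + 1 : ℝ))) volume xb,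
      integral_add_norm_sq_rpow hn (hA _), hc, rpow_add_one pi_ne_zero]
    have := hA (xd - yd)
    field_simp
  have hcont : Continuous fun yd : ℝ => π⁻¹ * (t / (t ^ 2 + (xd - yd) ^ 2)) := by
    refine continuous_const.mul (continuous_const.div (by fun_prop) fun yd => (hA _).ne')
  have hprod : Integrable (Function.uncurry fun (yb : EuclideanSpace ℝ (Fin n)) (yd : ℝ) =>
      c * ((t ^ 2 + (xd - yd) ^ 2) + ‖xb - yb‖ ^ 2) ^ (-(n / 2 + 1 : ℝ)))
      (volume.prod (volume.restrict (Ioo (-ε) 0))) := by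
    have hc2 : Continuous (Function.uncurry fun (yb : EuclideanSpace ℝ (Fin n)) (yd : ℝ) =>
        c * ((t ^ 2 + (xd - yd) ^ 2) + ‖xb - yb‖ ^ 2) ^ (-(n / 2 + 1 : ℝ))) := by
      refine continuous_const.mul (Continuous.rpow_const (by fun_prop) fun z => Or.inl ?_)
      have := hA (xd - z.2)
      positivity
    rw [integrable_prod_iff' hc2.aestronglyMeasurable]
    refine ⟨Eventually.of_forall hint, ?_⟩
    have habs (yb : EuclideanSpace ℝ (Fin n)) (yd : ℝ) :
        ‖c * ((t ^ 2 + (xd - yd) ^ 2) + ‖xb - yb‖ ^ 2) ^ (-(n / 2 + 1 : ℝ))‖ =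
          c * ((t ^ 2 + (xd - yd) ^ 2) + ‖xb - yb‖ ^ 2) ^ (-(n / 2 + 1 : ℝ)) :=
      norm_of_nonneg (by positivity)
    simp only [Function.uncurry, habs, hval]
    exact (hcont.integrableOn_Icc (a := -ε) (b := 0)).mono_set Ioo_subset_Icc_self
  rw [integral_integral_swap hprod]
  simp only [hval]
  rw [← integral_Ioc_eq_integral_Ioo, ← intervalIntegral.integral_of_le (by linarith),
    intervalIntegral.integral_eq_sub_of_hasDerivAt
      (f := fun yd => -(π⁻¹ * arctan ((xd - yd) / t))) (fun yd _ => ?_)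
      (hcont.intervalIntegrable _ _)]
  · simp only [sub_zero, sub_neg_eq_add]
    ring
  · refine ((((hasDerivAt_id yd).const_sub xd).div_const t).arctan.const_mul
      π⁻¹).neg.congr_deriv ?_
    have := hA (xd - yd)
    simp only [id]
    field_simp

theorem hasDerivAt_arctan_primitive {t : ℝ} (ht : 0 < t) (x : ℝ) :
    HasDerivAt (fun x => x * arctan (x / t) - t / 2 * log (t ^ 2 + x ^ 2)) (arctan (x / t)) x := by
  have hA : 0 < t ^ 2 + x ^ 2 := by positivity
  have h := ((hasDerivAt_id x).mul ((hasDerivAt_id x).div_const t).arctan).sub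
    ((((hasDerivAt_pow 2 x).const_add (t ^ 2)).log hA.ne').const_mul (t / 2))
  refine h.congr_deriv ?_
  simp only [id]
  field_simp
  ring

theorem abs_arctan_primitive_sub_le {x t : ℝ} (hx : 0 < x) (ht : 0 < t) (ht1 : t < 1) :
    |x * arctan (x / t) - t / 2 * log (t ^ 2 + x ^ 2) - x * (π / 2)| ≤
      (1 + (|log (x ^ 2)| + |log (1 + x ^ 2)|) / 2) * t := by
  have h1 : |x * arctan (x / t) - x * (π / 2)| ≤ t := by
    have h := mul_le_mul_of_nonneg_left (pi_div_two_sub_arctan_div_le hx ht) hx.le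
    rw [mul_div_cancel₀ _ hx.ne'] at h
    have := mul_lt_mul_of_pos_left (arctan_lt_pi_div_two (x / t)) hx
    rw [abs_le]
    constructor <;> linarith
  have h2 : |log (t ^ 2 + x ^ 2)| ≤ |log (x ^ 2)| + |log (1 + x ^ 2)| := by
    have hl : log (x ^ 2) ≤ log (t ^ 2 + x ^ 2) := log_le_log (by positivity) (by nlinarith)
    have hu : log (t ^ 2 + x ^ 2) ≤ log (1 + x ^ 2) := log_le_log (by positivity) (by nlinarith)
    rw [abs_le]
    constructor
    · linarith [neg_abs_le (log (x ^ 2)), abs_nonneg (log (1 + x ^ 2))]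
    · linarith [le_abs_self (log (1 + x ^ 2)), abs_nonneg (log (x ^ 2))]
  have h3 : |t / 2 * log (t ^ 2 + x ^ 2)| ≤
      t / 2 * (|log (x ^ 2)| + |log (1 + x ^ 2)|) := by
    rw [abs_mul, abs_of_pos (by positivity : 0 < t / 2)]
    gcongr
  rw [sub_right_comm]
  refine (abs_sub _ _).trans ?_
  linarith

theorem exists_abs_integral_arctan_sub_le {δ ε : ℝ} (hδ : 0 < δ) (hε : 0 < ε) :
    ∃ C : ℝ, 0 ≤ C ∧ ∀ t : ℝ, 0 < t → t < 1 →
      |(∫ x in Ioo 0 δ, (arctan ((x + ε) / t) - arctan (x / t)) / π) -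
        1 / π * (t * log (1 / t))| ≤ C * t := by
  set B : ℝ → ℝ := fun x => 1 + (|log (x ^ 2)| + |log (1 + x ^ 2)|) / 2 with hB
  have hB0 (x : ℝ) : 0 ≤ B x := by positivity
  refine ⟨(B (δ + ε) + B ε + B δ) / π, ?_, fun t ht ht1 => ?_⟩
  · have := hB0 (δ + ε); have := hB0 ε; have := hB0 δ
    positivity
  set G : ℝ → ℝ := fun x => x * arctan (x / t) - t / 2 * log (t ^ 2 + x ^ 2) with hG
  have hint : ∫ x in Ioo 0 δ, (arctan ((x + ε) / t) - arctan (x / t)) / π =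
      (G (δ + ε) - G ε - G δ + t * log (1 / t)) / π := by
    have h0 : G 0 = t * log (1 / t) := by
      simp [hG]
      ring
    rw [← integral_Ioc_eq_integral_Ioo, ← intervalIntegral.integral_of_le hδ.le,
      intervalIntegral.integral_div, intervalIntegral.integral_eq_sub_of_hasDerivAt
      (f := fun x => G (x + ε) - G x) (fun x _ =>
        ((hasDerivAt_arctan_primitive ht (x + ε)).comp_add_const x ε).sub
          (hasDerivAt_arctan_primitive ht x))
      (Continuous.intervalIntegrable (by fun_prop) _ _), h0, zero_add]
    ring
  have e : (G (δ + ε) - G ε - G δ + t * log (1 / t)) / π - 1 / π * (t * log (1 / t)) =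
      ((G (δ + ε) - (δ + ε) * (π / 2)) - (G ε - ε * (π / 2)) - (G δ - δ * (π / 2))) / π := by
    ring
  rw [hint, e, abs_div, abs_of_pos pi_pos, div_mul_eq_mul_div]
  gcongr
  have h1 : |G (δ + ε) - (δ + ε) * (π / 2)| ≤ B (δ + ε) * t :=
    abs_arctan_primitive_sub_le (add_pos hδ hε) ht ht1
  have h2 : |G ε - ε * (π / 2)| ≤ B ε * t := abs_arctan_primitive_sub_le hε ht ht1
  have h3 : |G δ - δ * (π / 2)| ≤ B δ * t := abs_arctan_primitive_sub_le hδ ht ht1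
  refine (abs_sub _ _).trans ?_
  have := abs_sub (G (δ + ε) - (δ + ε) * (π / 2)) (G ε - ε * (π / 2))
  linarith

theorem exists_abs_integral_integral_sub_le {E : Type*} [NormedAddCommGroup E] [NormedSpace ℝ E]
    [FiniteDimensional ℝ E] [MeasurableSpace E] [BorelSpace E] (μ : Measure E)
    [IsFiniteMeasureOnCompacts μ] [SFinite μ] {φ : E × ℝ → ℝ} (hφ : ContDiff ℝ 1 φ)
    (hsupp : HasCompactSupport φ) {δ : ℝ} (hδ : 0 < δ) :
    ∃ C : ℝ, 0 ≤ C ∧ ∀ (b : ℝ) (k : ℝ → ℝ), Continuous k → 0 ≤ b →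
      (∀ x, 0 < x → |x * k x| ≤ b) →
      |(∫ y, (∫ x in Ioo 0 δ, φ (y, x) * k x) ∂μ) -
        (∫ y, φ (y, 0) ∂μ) * ∫ x in Ioo 0 δ, k x| ≤ C * b := by
  obtain ⟨L, hL⟩ := hφ.lipschitzWith_of_hasCompactSupport hsupp one_ne_zero
  set S : Set E := Prod.fst '' tsupport φ with hS
  have hSc : IsCompact S := hsupp.isCompact.image continuous_fst
  have hφS (y : E) (hy : y ∉ S) (x : ℝ) : φ (y, x) = 0 := by
    by_contra h
    exact hy ⟨(y, x), subset_tsupport _ h, rfl⟩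
  refine ⟨L * δ * μ.real S, by positivity, fun b k hk hb hkb => ?_⟩
  have hφc := hφ.continuous
  have hk1 : IntegrableOn k (Ioo 0 δ) := hk.integrableOn_Icc.mono_set Ioo_subset_Icc_self
  have hφk (y : E) : IntegrableOn (fun x => φ (y, x) * k x) (Ioo 0 δ) :=
    (Continuous.integrableOn_Icc (by fun_prop)).mono_set Ioo_subset_Icc_self
  have hI0 : Integrable (fun y => φ (y, 0)) μ :=
    Continuous.integrable_of_hasCompactSupport (by fun_prop)
      (HasCompactSupport.intro hSc fun y hy => hφS y hy 0)
  have hI1 : Integrable (fun y => ∫ x in Ioo 0 δ, φ (y, x) * k x) μ := by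
    have hcs : HasCompactSupport fun z : E × ℝ => φ z * k z.2 := hsupp.mul_right
    have hint : Integrable (fun z : E × ℝ => φ z * k z.2) (μ.prod (volume.restrict (Ioo 0 δ))) :=
      Continuous.integrable_of_hasCompactSupport (by fun_prop) hcs
    exact hint.integral_prod_left
  rw [← integral_mul_const, ← integral_sub hI1 (hI0.mul_const _)]
  have hbound (y : E) : ‖(∫ x in Ioo 0 δ, φ (y, x) * k x) - φ (y, 0) * ∫ x in Ioo 0 δ, k x‖ ≤
      S.indicator (fun _ => L * δ * b) y := by
    by_cases hy : y ∈ S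
    · rw [indicator_of_mem hy, ← integral_const_mul,
        ← integral_sub (hφk y) (hk1.const_mul _)]
      refine (norm_setIntegral_le_of_norm_le_const (C := L * b) measure_Ioo_lt_top
        fun x hx => ?_).trans_eq ?_
      · have h1 : |φ (y, x) - φ (y, 0)| ≤ L * x := by
          have := hL.dist_le_mul (y, x) (y, 0)
          simpa [Real.dist_eq, Prod.dist_eq, abs_of_pos hx.1, hx.1.le] using this
        have h2 := hkb x hx.1
        rw [← sub_mul, norm_mul, norm_eq_abs, norm_eq_abs]
        rw [abs_mul, abs_of_pos hx.1] at h2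
        calc _ ≤ L * x * |k x| := by gcongr
          _ = L * (x * |k x|) := by ring
          _ ≤ L * b := by gcongr
      · simp [measureReal_def, hδ.le]
        ring
    · simp [indicator_of_notMem hy, hφS y hy]
  refine (norm_integral_le_of_norm_le ?_ (Eventually.of_forall hbound)).trans_eq ?_
  · exact (integrable_indicator_iff hSc.measurableSet).2
      (integrableOn_const hSc.measure_lt_top.ne)
  · rw [integral_indicator hSc.measurableSet]
    simp
    ring

/-- small-time expansion of the Cauchy heat content between slabs tested
against a `C_c^1` function.  Points of `ℝ^d` are written as pairs `(x̄, x_d) ∈ ℝ^{d-1} × ℝ`. -/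
theorem cauchy_slab_expansion (d : ℕ) (hd : 2 ≤ d) (δ ε : ℝ) (hδ : 0 < δ) (hε : 0 < ε)
    (φ : (EuclideanSpace ℝ (Fin (d - 1)) × ℝ) → ℝ)
    (hφ : ContDiff ℝ 1 φ) (hsupp : HasCompactSupport φ) :
    ∃ C : ℝ, 0 < C ∧ ∀ t : ℝ, 0 < t → t < Real.exp (-1) →
      |(∫ xb : EuclideanSpace ℝ (Fin (d - 1)), ∫ xd in Set.Ioo 0 δ, φ (xb, xd) *
          (∫ yb : EuclideanSpace ℝ (Fin (d - 1)), ∫ yd in Set.Ioo (-ε) 0,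
            (Real.Gamma (((d : ℝ) + 1)/2) / Real.pi ^ (((d : ℝ) + 1)/2)) * t /
              (t ^ 2 + ‖xb - yb‖ ^ 2 + (xd - yd) ^ 2) ^ (((d : ℝ) + 1)/2)))
        - (1 / Real.pi) * (∫ xb : EuclideanSpace ℝ (Fin (d - 1)), φ (xb, 0))
            * (t * Real.log (1/t))|
      ≤ C * t := by
  obtain ⟨n, rfl⟩ : ∃ n, d = n + 1 := ⟨d - 1, by omega⟩
  have hn : n + 1 - 1 ≠ 0 := by omega
  obtain ⟨C₁, hC₁, h₁⟩ := exists_abs_integral_integral_sub_le volume hφ hsupp hδ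
  obtain ⟨C₂, hC₂, h₂⟩ := exists_abs_integral_arctan_sub_le hδ hε
  set J := ∫ xb : EuclideanSpace ℝ (Fin (n + 1 - 1)), φ (xb, 0)
  refine ⟨C₁ / π + |J| * C₂ + 1, by positivity, fun t ht hte => ?_⟩
  have ht1 : t < 1 := hte.trans (by simp)
  have hslab := fun (xb : EuclideanSpace ℝ (Fin (n + 1 - 1))) (xd : ℝ) =>
    integral_cauchy_slab hn hε ht xb xd
  simp only [Nat.add_sub_cancel] at hslab
  simp only [hslab]
  have hk (x : ℝ) (hx : 0 < x) :
      |x * ((arctan ((x + ε) / t) - arctan (x / t)) / π)| ≤ t / π := by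
    have h := pi_div_two_sub_arctan_div_le hx ht
    rw [le_div_iff₀ hx] at h
    have h' := mul_lt_mul_of_pos_right (arctan_lt_pi_div_two ((x + ε) / t)) hx
    have hm : arctan (x / t) ≤ arctan ((x + ε) / t) := arctan_mono (by gcongr; linarith)
    have hm0 := sub_nonneg.2 hm
    rw [abs_of_nonneg (by positivity), ← mul_div_assoc]
    gcongr
    linarith
  have key₁ := h₁ (t / π) (fun x => (arctan ((x + ε) / t) - arctan (x / t)) / π)
    (by fun_prop) (by positivity) hk
  have key₂ := mul_le_mul_of_nonneg_left (h₂ t ht ht1) (abs_nonneg J)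
  rw [← abs_mul] at key₂
  have key := (abs_add_le _ _).trans (add_le_add key₁ key₂)
  refine (le_of_eq ?_).trans (key.trans ?_)
  · congr 1
    ring
  · have : C₁ * (t / π) = C₁ / π * t := by ring
    linarith
end

section
/- Let d ≥ 2, let Ω ⊂ ℝ^d be a bounded open set (domain), and let ε, δ > 0. Then lim_{t↓0} H^{(1)}_{Ω∖Ω_ε, Ω^c}(t)/(t·ln(1/t)) = 0 and lim_{t↓0} H^{(1)}_{Ω_ε, Ω^c∖Ω^δ}(t)/(t·ln(1/t)) = 0. -/
open MeasureTheory Real Filter Set Metric Topology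

noncomputable def cauchyKernelD (d : ℕ) (t : ℝ) (x : EuclideanSpace ℝ (Fin d)) : ℝ :=
  (Real.Gamma (((d : ℝ) + 1) / 2) / Real.pi ^ (((d : ℝ) + 1) / 2)) * t /
    (t ^ 2 + ‖x‖ ^ 2) ^ (((d : ℝ) + 1) / 2)

noncomputable def cauchyContentD (d : ℕ) (t : ℝ) (A B : Set (EuclideanSpace ℝ (Fin d))) : ℝ :=
  ∫ x in A, (∫ y in B, cauchyKernelD d t (x - y))

/-- A preconnected set meeting both a set and its complement meets the frontier of that set. -/
theorem IsPreconnected.nonempty_inter_frontier {X : Type*} [TopologicalSpace X] {s t : Set X}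
    (ht : IsPreconnected t) (hs : (t ∩ s).Nonempty) (hsc : (t ∩ sᶜ).Nonempty) :
    (t ∩ frontier s).Nonempty := by
  by_contra hempty
  have hint : ∀ z ∈ t, z ∈ s → z ∈ interior s := fun z hz hzs =>
    by_contra fun h => hempty ⟨z, hz, subset_closure hzs, h⟩
  have hintc : ∀ z ∈ t, z ∈ sᶜ → z ∈ interior sᶜ := fun z hz hzs =>
    by_contra fun h => hempty ⟨z, hz, by
      rw [← frontier_compl]
      exact ⟨subset_closure hzs, h⟩⟩
  obtain ⟨x, hxt, hxs⟩ := hs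
  obtain ⟨y, hyt, hys⟩ := hsc
  obtain ⟨z, -, hz, hz'⟩ := ht _ _ isOpen_interior isOpen_interior
    (fun z hz => (em (z ∈ s)).imp (hint z hz) (hintc z hz))
    ⟨x, hxt, hint x hxt hxs⟩ ⟨y, hyt, hintc y hyt hys⟩
  exact interior_subset hz' (interior_subset hz)

/-- A point of the segment joining a point of a set to a point of its complement lies on the
frontier, so each endpoint is at least as far from the other as from the frontier. -/
theorem infDist_frontier_le_dist {E : Type*} [NormedAddCommGroup E] [NormedSpace ℝ E]
    {s : Set E} {x y : E} (hx : x ∈ s) (hy : y ∈ sᶜ) :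
    Metric.infDist x (frontier s) ≤ dist x y ∧ Metric.infDist y (frontier s) ≤ dist x y := by
  obtain ⟨z, hz, hzs⟩ := (convex_segment (𝕜 := ℝ) x y).isPreconnected.nonempty_inter_frontier
    ⟨x, left_mem_segment ℝ x y, hx⟩ ⟨y, right_mem_segment ℝ x y, hy⟩
  have hxz : dist z x ≤ dist x y := segment_subset_closedBall_left x y hz
  have hyz : dist z y ≤ dist x y := segment_subset_closedBall_right x y hz
  rw [dist_comm] at hxz hyz
  exact ⟨(Metric.infDist_le_dist_of_mem hzs).trans hxz,
    (Metric.infDist_le_dist_of_mem hzs).trans hyz⟩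

theorem cauchyKernelD_nonneg {d : ℕ} {t : ℝ} (ht : 0 ≤ t) (x : EuclideanSpace ℝ (Fin d)) :
    0 ≤ cauchyKernelD d t x := by
  have := Real.Gamma_pos_of_pos (show (0 : ℝ) < ((d : ℝ) + 1) / 2 by positivity)
  unfold cauchyKernelD
  positivity

/-- Away from the origin the Cauchy kernel is bounded by `t` times an integrable function. -/
theorem exists_cauchyKernelD_le (d : ℕ) {r : ℝ} (hr : 0 < r) :
    ∃ C : ℝ, ∀ t : ℝ, 0 < t → ∀ z : EuclideanSpace ℝ (Fin d), r ≤ ‖z‖ →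
      cauchyKernelD d t z ≤ C * t * (1 + ‖z‖) ^ (-((d : ℝ) + 1)) := by
  set c : ℝ := Real.Gamma (((d : ℝ) + 1) / 2) / Real.pi ^ (((d : ℝ) + 1) / 2) with hc_def
  have hc : 0 ≤ c := by
    have := Real.Gamma_pos_of_pos (show (0 : ℝ) < ((d : ℝ) + 1) / 2 by positivity)
    positivity
  set k : ℝ := r / (1 + r)
  have hk : 0 < k := by positivity
  refine ⟨c / k ^ ((d : ℝ) + 1), fun t ht z hz => ?_⟩
  have hkz : k * (1 + ‖z‖) ≤ ‖z‖ := by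
    rw [div_mul_eq_mul_div, div_le_iff₀ (by positivity)]
    nlinarith
  have hpow : k ^ ((d : ℝ) + 1) * (1 + ‖z‖) ^ ((d : ℝ) + 1) ≤
      (t ^ 2 + ‖z‖ ^ 2) ^ (((d : ℝ) + 1) / 2) := by
    rw [← Real.mul_rpow hk.le (by positivity)]
    calc (k * (1 + ‖z‖)) ^ ((d : ℝ) + 1) ≤ ‖z‖ ^ ((d : ℝ) + 1) := by gcongr
      _ = (‖z‖ ^ 2) ^ (((d : ℝ) + 1) / 2) := by
        rw [← Real.rpow_natCast, ← Real.rpow_mul (norm_nonneg z)]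
        congr 1
        push_cast
        ring
      _ ≤ (t ^ 2 + ‖z‖ ^ 2) ^ (((d : ℝ) + 1) / 2) := by
        gcongr
        nlinarith [sq_nonneg t]
  calc cauchyKernelD d t z = c * t / (t ^ 2 + ‖z‖ ^ 2) ^ (((d : ℝ) + 1) / 2) := rfl
    _ ≤ c * t / (k ^ ((d : ℝ) + 1) * (1 + ‖z‖) ^ ((d : ℝ) + 1)) := by gcongr
    _ = c / k ^ ((d : ℝ) + 1) * t * (1 + ‖z‖) ^ (-((d : ℝ) + 1)) := by
      rw [Real.rpow_neg (by positivity)]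
      field_simp

/-- The Cauchy heat content between two sets at positive distance is `O(t)`. -/
theorem exists_norm_cauchyContentD_le {d : ℕ} {A B : Set (EuclideanSpace ℝ (Fin d))}
    (hA : volume A < ⊤) (hB : MeasurableSet B) {r : ℝ} (hr : 0 < r)
    (hAB : ∀ x ∈ A, ∀ y ∈ B, r ≤ dist x y) :
    ∃ C : ℝ, ∀ t : ℝ, 0 < t → ‖cauchyContentD d t A B‖ ≤ C * t := by
  obtain ⟨C, hC⟩ := exists_cauchyKernelD_le d hr
  set g : EuclideanSpace ℝ (Fin d) → ℝ := fun z => (1 + ‖z‖) ^ (-((d : ℝ) + 1))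
  have hg : Integrable g volume := integrable_one_add_norm (by simp)
  have hg0 : ∀ z, 0 ≤ g z := fun z => by positivity
  refine ⟨|C| * (∫ z, g z) * volume.real A, fun t ht => ?_⟩
  have key : ∀ x ∈ A, ‖∫ y in B, cauchyKernelD d t (x - y)‖ ≤ |C| * t * ∫ z, g z := by
    intro x hx
    have hgx : Integrable (fun y => g (x - y)) volume := hg.comp_sub_left x
    rw [Real.norm_of_nonneg (integral_nonneg fun y => cauchyKernelD_nonneg ht.le _)]
    calc ∫ y in B, cauchyKernelD d t (x - y) ≤ ∫ y in B, |C| * t * g (x - y) := by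
          refine integral_mono_of_nonneg
            (Eventually.of_forall fun y => cauchyKernelD_nonneg ht.le _)
            (hgx.const_mul _).integrableOn ?_
          refine (ae_restrict_iff' hB).2 (Eventually.of_forall fun y hy => ?_)
          refine (hC t ht (x - y) (by simpa [dist_eq_norm] using hAB x hx y hy)).trans ?_
          exact mul_le_mul_of_nonneg_right
            (mul_le_mul_of_nonneg_right (le_abs_self C) ht.le) (hg0 _)
      _ ≤ ∫ y, |C| * t * g (x - y) :=
          setIntegral_le_integral (hgx.const_mul _)
            (Eventually.of_forall fun y => mul_nonneg (by positivity) (hg0 _))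
      _ = |C| * t * ∫ z, g z := by
          rw [integral_const_mul, integral_sub_left_eq_self g volume x]
  calc ‖cauchyContentD d t A B‖ ≤ |C| * t * (∫ z, g z) * volume.real A :=
        norm_setIntegral_le_of_norm_le_const hA key
    _ = |C| * (∫ z, g z) * volume.real A * t := by ring

/-- The Cauchy heat content between two sets at positive distance is `o(t ln(1/t))`. -/
theorem tendsto_cauchyContentD_div {d : ℕ} {A B : Set (EuclideanSpace ℝ (Fin d))}
    (hA : volume A < ⊤) (hB : MeasurableSet B) {r : ℝ} (hr : 0 < r)
    (hAB : ∀ x ∈ A, ∀ y ∈ B, r ≤ dist x y) :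
    Tendsto (fun t : ℝ => cauchyContentD d t A B / (t * Real.log (1 / t))) (𝓝[>] 0) (𝓝 0) := by
  obtain ⟨C, hC⟩ := exists_norm_cauchyContentD_le hA hB hr hAB
  have hlog : Tendsto (fun t : ℝ => Real.log (1 / t)) (𝓝[>] 0) atTop := by
    simpa only [one_div, Function.comp_def] using Real.tendsto_log_atTop.comp tendsto_inv_nhdsGT_zero
  refine squeeze_zero_norm' ?_ (hlog.const_div_atTop C)
  filter_upwards [self_mem_nhdsWithin, hlog.eventually_gt_atTop 0] with t ht hl
  have ht : 0 < t := ht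
  rw [norm_div, Real.norm_of_nonneg (mul_pos ht hl).le, div_le_div_iff₀ (mul_pos ht hl) hl]
  calc ‖cauchyContentD d t A B‖ * Real.log (1 / t) ≤ C * t * Real.log (1 / t) := by
        gcongr
        exact hC t ht
    _ = C * (t * Real.log (1 / t)) := by ring

/-- the Cauchy heat content between sets staying away from the boundary is
`o(t ln(1/t))` as `t ↓ 0`. -/
theorem cauchy_heat_content_away_from_boundary (d : ℕ) (hd : 2 ≤ d)
    (Ω : Set (EuclideanSpace ℝ (Fin d))) (hopen : IsOpen Ω) (hbdd : Bornology.IsBounded Ω)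
    (ε δ : ℝ) (hε : 0 < ε) (hδ : 0 < δ) :
    Filter.Tendsto
      (fun t : ℝ =>
        cauchyContentD d t (Ω \ {x ∈ Ω | Metric.infDist x (frontier Ω) < ε}) Ωᶜ
          / (t * Real.log (1/t)))
      (nhdsWithin 0 (Set.Ioi 0)) (nhds 0) ∧
    Filter.Tendsto
      (fun t : ℝ =>
        cauchyContentD d t {x ∈ Ω | Metric.infDist x (frontier Ω) < ε}
            (Ωᶜ \ {y ∈ Ωᶜ | Metric.infDist y (frontier Ω) < δ})
          / (t * Real.log (1/t)))
      (nhdsWithin 0 (Set.Ioi 0)) (nhds 0) := by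
  have hcont : Continuous fun x => Metric.infDist x (frontier Ω) :=
    Metric.continuous_infDist_pt _
  constructor
  · refine tendsto_cauchyContentD_div ((hbdd.subset sdiff_subset).measure_lt_top)
      hopen.measurableSet.compl hε fun x hx y hy => ?_
    have hxε : ε ≤ Metric.infDist x (frontier Ω) := not_lt.1 fun h => hx.2 ⟨hx.1, h⟩
    exact hxε.trans (infDist_frontier_le_dist hx.1 hy).1
  · refine tendsto_cauchyContentD_div ((hbdd.subset (sep_subset _ _)).measure_lt_top)
      (hopen.measurableSet.compl.diff (hopen.measurableSet.compl.inter
        (measurableSet_lt hcont.measurable measurable_const))) hδ fun x hx y hy => ?_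
    have hyδ : δ ≤ Metric.infDist y (frontier Ω) := not_lt.1 fun h => hy.2 ⟨hy.1, h⟩
    exact hyδ.trans (infDist_frontier_le_dist hx.1 hy.1).2
end

section
/- For every w ≥ 0, one has ∫_0^∞ exp(−w²/s) · (1/(2√π)) · s^{−3/2} · exp(−1/(4s)) ds = 1/√(4w² + 1). (Equivalently, if S_1 is a 1/2-stable subordinator at time 1, with density η_1^{(1/2)}(s) = (1/(2√π))·s^{−3/2}·e^{−1/(4s)}, then E[exp(−w²/S_1)] = 1/√(4w²+1).) -/
open MeasureTheory Real Filter Set Metric Topology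

/-- Substituting `y = s ^ (-1/2)` turns this integral into a Gaussian one. -/
theorem integral_rpow_neg_three_half_mul_exp_neg_div (b : ℝ) :
    ∫ s in Set.Ioi (0 : ℝ), s ^ (-(3 : ℝ) / 2) * Real.exp (-b / s) = Real.sqrt (Real.pi / b) := by
  have h := integral_comp_rpow_Ioi (fun y : ℝ => 2 * Real.exp (-b * y ^ 2))
    (p := -(1 / 2 : ℝ)) (by norm_num)
  rw [integral_const_mul, integral_gaussian_Ioi, mul_div_cancel₀ _ two_ne_zero] at h
  rw [← h]
  refine setIntegral_congr_fun measurableSet_Ioi fun s hs => ?_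
  have hs' : (0 : ℝ) < s := hs
  have hsq : (s ^ (-(1 / 2 : ℝ))) ^ 2 = s⁻¹ := by
    rw [← rpow_natCast, ← rpow_mul hs'.le, ← rpow_neg_one]
    norm_num
  have habs : |(-(1 / 2 : ℝ))| = 1 / 2 := by norm_num [abs_of_pos]
  have hexp : -(1 / 2 : ℝ) - 1 = -(3 : ℝ) / 2 := by norm_num
  simp only [smul_eq_mul, hsq, habs, hexp, div_eq_mul_inv (-b) s]
  ring

/-- `E[exp(-w²/S₁)] = 1/√(4w²+1)` for the `1/2`-stable subordinator. -/
theorem half_subordinator_exp_moment (w : ℝ) (hw : 0 ≤ w) :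
    ∫ s in Set.Ioi (0 : ℝ),
        Real.exp (-w ^ 2 / s) * ((1 / (2 * Real.sqrt Real.pi)) * s ^ (-(3 : ℝ)/2)
          * Real.exp (-1 / (4 * s)))
      = 1 / Real.sqrt (4 * w ^ 2 + 1) := by
  have hcongr : ∀ s ∈ Set.Ioi (0 : ℝ),
      Real.exp (-w ^ 2 / s) * ((1 / (2 * Real.sqrt Real.pi)) * s ^ (-(3 : ℝ)/2)
          * Real.exp (-1 / (4 * s)))
        = (1 / (2 * Real.sqrt Real.pi)) *
          (s ^ (-(3 : ℝ) / 2) * Real.exp (-((4 * w ^ 2 + 1) / 4) / s)) := by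
    intro s hs
    have hs' : s ≠ 0 := ne_of_gt hs
    have hsum : -((4 * w ^ 2 + 1) / 4) / s = -w ^ 2 / s + -1 / (4 * s) := by
      field_simp
      ring
    rw [hsum, Real.exp_add]
    ring
  have hsqrt4 : Real.sqrt 4 = 2 := by
    rw [show (4 : ℝ) = 2 ^ 2 by norm_num, Real.sqrt_sq (by norm_num)]
  have hpi : Real.sqrt Real.pi ≠ 0 := (Real.sqrt_pos.2 Real.pi_pos).ne'
  have hroot : Real.sqrt (4 * w ^ 2 + 1) ≠ 0 := (Real.sqrt_pos.2 (by positivity)).ne'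
  rw [setIntegral_congr_fun measurableSet_Ioi hcongr, integral_const_mul,
    integral_rpow_neg_three_half_mul_exp_neg_div, Real.sqrt_div Real.pi_pos.le,
    Real.sqrt_div (by positivity), hsqrt4]
  field_simp
end

section
/- Let d ≥ 1, α > 0, and let Ω ⊂ ℝ^d be a bounded open set satisfying a uniform exterior volume condition: there exists c > 0 such that for every σ ∈ ∂Ω and every r > 0, the Lebesgue measure of B_r(σ) ∩ Ω^c is at least c·r^d. Then for every x ∈ Ω, (c/2^{d+α}) · ρ_Ω(x)^{−α} ≤ ∫_{Ω^c} |x − y|^{−d−α} dy, where ρ_Ω(x) = inf{|x − σ| : σ ∈ ∂Ω}. -/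
open MeasureTheory Real Filter Set Metric Topology

/-- The kernel `‖x - y‖ ^ (-s)` with `s` above the dimension is integrable away from `x`. -/
theorem integrableOn_rpow_norm_sub_of_ball_subset_compl {E : Type*} [NormedAddCommGroup E]
    [NormedSpace ℝ E] [FiniteDimensional ℝ E] [MeasurableSpace E] [BorelSpace E]
    (μ : Measure E) [μ.IsAddHaarMeasure] {s : ℝ} (hs : (Module.finrank ℝ E : ℝ) < s)
    {x : E} {A : Set E} (hA : MeasurableSet A) {ε : ℝ} (hε : 0 < ε) (hball : ball x ε ⊆ Aᶜ) :
    IntegrableOn (fun y => ‖x - y‖ ^ (-s)) A μ := by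
  have hs0 : 0 ≤ s := (Nat.cast_nonneg _).trans hs.le
  have hK : 0 < 1 + 1 / ε := by positivity
  have hint : Integrable (fun y : E => (1 + 1 / ε) ^ s * (1 + ‖x - y‖) ^ (-s)) μ :=
    ((integrable_one_add_norm (μ := μ) hs).comp_sub_left x).const_mul _
  refine hint.integrableOn.mono' ?_ ?_
  · exact ((measurable_const.sub measurable_id).norm.pow_const _).aestronglyMeasurable
  · filter_upwards [ae_restrict_mem hA] with y hy
    have hε_le : ε ≤ ‖x - y‖ := by
      by_contra! h
      exact hball (by rwa [mem_ball, dist_comm, dist_eq_norm]) hy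
    have hpos : 0 < ‖x - y‖ := hε.trans_le hε_le
    have hle : 1 + ‖x - y‖ ≤ (1 + 1 / ε) * ‖x - y‖ := by
      have : 1 ≤ ‖x - y‖ / ε := (one_le_div hε).2 hε_le
      calc 1 + ‖x - y‖ ≤ ‖x - y‖ / ε + ‖x - y‖ := by gcongr
        _ = _ := by ring
    rw [Real.norm_of_nonneg (by positivity)]
    calc ‖x - y‖ ^ (-s)
        = (1 + 1 / ε) ^ s * ((1 + 1 / ε) * ‖x - y‖) ^ (-s) := by
          rw [Real.mul_rpow hK.le hpos.le, ← mul_assoc, ← Real.rpow_add hK, add_neg_cancel,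
            Real.rpow_zero, one_mul]
      _ ≤ _ := by
          gcongr ?_ * ?_
          exact Real.rpow_le_rpow_of_nonpos (by positivity) hle (by linarith)

/-- under a uniform exterior volume condition, the distance to the boundary
controls the fractional perimeter density from below. -/
theorem exterior_volume_lower_bound (d : ℕ) (hd : 1 ≤ d) (α : ℝ) (hα : 0 < α)
    (Ω : Set (EuclideanSpace ℝ (Fin d))) (hopen : IsOpen Ω) (hbdd : Bornology.IsBounded Ω)
    (c : ℝ) (hc : 0 < c)
    (hext : ∀ σ ∈ frontier Ω, ∀ r : ℝ, 0 < r →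
      c * r ^ d ≤ (volume (Metric.ball σ r ∩ Ωᶜ)).toReal) :
    ∀ x ∈ Ω,
      c / 2 ^ ((d : ℝ) + α) * Metric.infDist x (frontier Ω) ^ (-α)
        ≤ ∫ y in Ωᶜ, ‖x - y‖ ^ (-((d : ℝ) + α)) := by
  intro x hx
  have : Nonempty (Fin d) := ⟨⟨0, hd⟩⟩
  have hne : (frontier Ω).Nonempty := by
    refine nonempty_frontier_iff.2 ⟨⟨x, hx⟩, ?_⟩
    rintro rfl
    exact NormedSpace.unbounded_univ ℝ (EuclideanSpace ℝ (Fin d)) hbdd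
  obtain ⟨σ, hσ, hdist⟩ := isClosed_frontier.exists_infDist_eq_dist hne x
  have hxσ : x ≠ σ := by
    rintro rfl
    rw [hopen.frontier_eq] at hσ
    exact hσ.2 hx
  rw [hdist]
  set ρ := dist x σ
  have hρ : 0 < ρ := dist_pos.2 hxσ
  have hmeas : MeasurableSet Ωᶜ := hopen.measurableSet.compl
  have hint : IntegrableOn (fun y => ‖x - y‖ ^ (-((d : ℝ) + α))) Ωᶜ volume := by
    obtain ⟨ε, hε, hball⟩ := Metric.isOpen_iff.1 hopen x hx
    exact integrableOn_rpow_norm_sub_of_ball_subset_compl volume (by simpa using hα) hmeas hε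
      (by rwa [compl_compl])
  calc c / 2 ^ ((d : ℝ) + α) * ρ ^ (-α)
      = (c * ρ ^ d) * (2 * ρ) ^ (-((d : ℝ) + α)) := by
        rw [Real.mul_rpow zero_le_two hρ.le, Real.rpow_neg zero_le_two, neg_add,
          Real.rpow_add hρ, Real.rpow_neg hρ.le (d : ℝ), Real.rpow_natCast]
        field_simp
    _ ≤ volume.real (ball σ ρ ∩ Ωᶜ) * (2 * ρ) ^ (-((d : ℝ) + α)) := by
        gcongr
        exact hext σ hσ ρ hρ
    _ = ∫ _ in ball σ ρ ∩ Ωᶜ, (2 * ρ) ^ (-((d : ℝ) + α)) := by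
        rw [setIntegral_const, smul_eq_mul]
    _ ≤ ∫ y in ball σ ρ ∩ Ωᶜ, ‖x - y‖ ^ (-((d : ℝ) + α)) := by
        refine setIntegral_mono_on ?_ (hint.mono_set inter_subset_right)
          (measurableSet_ball.inter hmeas) ?_
        · exact integrableOn_const
            ((measure_mono inter_subset_left).trans_lt measure_ball_lt_top).ne
        · rintro y ⟨hy, hyΩ⟩
          have hxy : 0 < ‖x - y‖ := norm_sub_pos_iff.2 fun h => hyΩ (h ▸ hx)
          refine Real.rpow_le_rpow_of_nonpos hxy ?_ (by linarith [(Nat.cast_nonneg d : (0 : ℝ) ≤ d)])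
          rw [← dist_eq_norm]
          linarith [dist_triangle_right x y σ, mem_ball.1 hy]
    _ ≤ ∫ y in Ωᶜ, ‖x - y‖ ^ (-((d : ℝ) + α)) :=
        setIntegral_mono_set hint (ae_of_all _ fun y => by positivity)
          inter_subset_right.eventuallyLE
end
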